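/- arXiv:1603.01828 — 2 statements merged into one kernel-verified Lean document; each statement's English description precedes it below -/
import Mathlib

section
/- Assume n_1 < n_3 < n_2 < n_4 (so n = n_4). Fix a Smith datum (U^{(1)}, V^{(1)}, d^{(1)}_1 | … | d^{(1)}_{s_1}) for E_{11}, a Smith datum (U^{(3)}, V^{(3)}, d^{(3)}_1 | … | d^{(3)}_{s_3}) for (E_{11}; E_{21}), a Smith datum (U^{(2)}, V^{(2)}, d^{(2)}_1 | … | d^{(2)}_{s_2}) for (E_{11}; E_{12}; E_{21}), and a Smith datum (U^{(4)}, V^{(4)}, d^{(4)}_1 | … | d^{(4)}_{s_4}) for (E_{11}; E_{12}; E_{21}; E_{22}). Define H_1 = #{(u_1,…,u_{r_1}) ∈ (F_q^*)^{r_1} : Σ_{i=1}^{r_1} a_{1,i} u_i = b_1 and u satisfies the index condition for (E_{11}, U^{(1)}, d^{(1)})}; H_3 = #{(u_1,…,u_{r_1}, v_1,…,v_{r_3}) ∈ (F_q^*)^{r_1+r_3} : Σ_{i=1}^{r_1} a_{1,i} u_i = b_1, Σ_{j=1}^{r_3} a_{2,j} v_j = b_2, and (u,v) satisfies the index condition for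 ((E_{11}; E_{21}), U^{(3)}, d^{(3)})}; H_2 = #{(u_1,…,u_{r_2}, v_1,…,v_{r_3}) ∈ (F_q^*)^{r_2+r_3} : Σ_{i=1}^{r_2} a_{1,i} u_i = b_1, Σ_{j=1}^{r_3} a_{2,j} v_j = b_2, and (u,v) satisfies the index condition for ((E_{11}; E_{12}; E_{21}), U^{(2)}, d^{(2)})}; H_4 = #{(u_1,…,u_{r_2}, v_1,…,v_{r_4}) ∈ (F_q^*)^{r_2+r_4} : Σ_{i=1}^{r_2} a_{1,i} u_i = b_1, Σ_{j=1}^{r_4} a_{2,j} v_j = b_2, and (u,v) satisfies the index condition for ((E_{11}; E_{12}; E_{21}; E_{22}), U^{(4)}, d^{(4)})}; and for l = 1,2,3,4 set L_l = H_l · (q−1)^{n_l − s_l} · ∏_{j=1}^{s_l} gcd(q−1, d^{(l)}_j). Then N = N_0 + N_1 + N_2 + N_3 + N_4, where N_0 = q^{n_4−n_1}(q^{n_1} − (q−1)^{n_1}) if b_1 = b_2 = 0 and N_0 = 0 otherwise; N_1 = q^{n_4−n_3}(q^{n_3−n_1} − (q−1)^{n_3−n_1}) L_1 if b_2 = 0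 and N_1 = 0 otherwise; N_2 = q^{n_4−n_2}(q^{n_2−n_3} − (q−1)^{n_2−n_3}) L_3; N_3 = (q^{n_4−n_2} − (q−1)^{n_4−n_2}) L_2; and N_4 = L_4. -/
open Finset

/-- Stack the first `p1` rows of `E1` on top of the first `p2` rows of `E2`,
viewed as an integer matrix with `n` columns. -/
def stackM (E1 E2 : ℕ → ℕ → ℕ) (p1 p2 n : ℕ) :
    Matrix (Fin (p1 + p2)) (Fin n) ℤ :=
  Matrix.of fun i j =>
    if (i : ℕ) < p1 then (E1 (i : ℕ) (j : ℕ) : ℤ) else (E2 ((i : ℕ) - p1) (j : ℕ) : ℤ)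

/-- `(U, V, d 0 ∣ d 1 ∣ ⋯ ∣ d (s-1))` is a Smith datum for the matrix `M`:
`U` and `V` are unimodular and `U * M * V` is diagonal with the positive
invariant factors `d 0 ∣ ⋯ ∣ d (s-1)` on the diagonal and zeros elsewhere. -/
def IsSmithDatum {ρ n : ℕ} (M : Matrix (Fin ρ) (Fin n) ℤ)
    (U : Matrix (Fin ρ) (Fin ρ) ℤ) (V : Matrix (Fin n) (Fin n) ℤ)
    (s : ℕ) (d : ℕ → ℕ) : Prop :=
  IsUnit U.det ∧ IsUnit V.det ∧ s ≤ ρ ∧ s ≤ n ∧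
    (∀ j, j < s → 0 < d j) ∧ (∀ j, j + 1 < s → d j ∣ d (j + 1)) ∧
    ∀ i k, (U * M * V) i k =
      if (i : ℕ) = (k : ℕ) ∧ (i : ℕ) < s then (d (i : ℕ) : ℤ) else 0

/-- The index condition: writing `h' = U ⬝ w` (where `w` is the vector of
indices of the `uᵢ`), one has `gcd (m, d j) ∣ h'_j` for `j < s` and
`m ∣ h'_j` for `s ≤ j`. Here `m` plays the role of `q - 1`. -/
def IndexCond {ρ : ℕ} (m : ℕ) (U : Matrix (Fin ρ) (Fin ρ) ℤ)
    (s : ℕ) (d : ℕ → ℕ) (w : Fin ρ → ℤ) : Prop :=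
  ∀ j : Fin ρ,
    (if (j : ℕ) < s then ((Nat.gcd m (d (j : ℕ))) : ℤ) else (m : ℤ)) ∣ (U.mulVec w) j

section MonomialMap

variable {G : Type*} [CommGroup G]

theorem prod_zpow_eq_zpow_sum {ι : Type*} (t : Finset ι) (f : ι → ℤ) (g : G) :
    ∏ i ∈ t, g ^ f i = g ^ ∑ i ∈ t, f i := by
  classical
  induction t using Finset.induction_on with
  | empty => simp
  | insert i t hi ih => rw [Finset.prod_insert hi, Finset.sum_insert hi, zpow_add, ih]

/-- The homomorphism sending `x` to the tuple of monomials whose exponents are the rows of `M`. -/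
def monomialMap {ρ n : ℕ} (M : Matrix (Fin ρ) (Fin n) ℤ) : (Fin n → G) →* (Fin ρ → G) where
  toFun x i := ∏ j, x j ^ M i j
  map_one' := by ext; simp
  map_mul' x y := by ext; simp [mul_zpow, Finset.prod_mul_distrib]

theorem monomialMap_apply {ρ n : ℕ} (M : Matrix (Fin ρ) (Fin n) ℤ) (x : Fin n → G) (i : Fin ρ) :
    monomialMap M x i = ∏ j, x j ^ M i j := rfl

theorem monomialMap_mul {k m n : ℕ} (A : Matrix (Fin k) (Fin m) ℤ) (B : Matrix (Fin m) (Fin n) ℤ)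
    (x : Fin n → G) : monomialMap (A * B) x = monomialMap A (monomialMap B x) := by
  ext i
  simp only [monomialMap_apply, Matrix.mul_apply, ← Finset.prod_zpow]
  rw [Finset.prod_comm]
  refine Finset.prod_congr rfl fun j _ => ?_
  rw [← prod_zpow_eq_zpow_sum]
  exact Finset.prod_congr rfl fun l _ => by rw [mul_comm, zpow_mul]

theorem monomialMap_one {n : ℕ} (x : Fin n → G) :
    monomialMap (1 : Matrix (Fin n) (Fin n) ℤ) x = x := by
  ext i
  rw [monomialMap_apply, Finset.prod_eq_single i] <;> simp +contextual [eq_comm]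

/-- A unimodular matrix induces an automorphism of `Fin n → G`. -/
noncomputable def monomialEquiv {n : ℕ} (U : Matrix (Fin n) (Fin n) ℤ) (hU : IsUnit U.det) :
    (Fin n → G) ≃ (Fin n → G) where
  toFun := monomialMap U
  invFun := monomialMap U⁻¹
  left_inv x := by rw [← monomialMap_mul, Matrix.nonsing_inv_mul U hU, monomialMap_one]
  right_inv x := by rw [← monomialMap_mul, Matrix.mul_nonsing_inv U hU, monomialMap_one]

theorem monomialEquiv_apply {n : ℕ} (U : Matrix (Fin n) (Fin n) ℤ) (hU : IsUnit U.det)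
    (x : Fin n → G) : monomialEquiv U hU x = monomialMap U x := rfl

theorem monomialMap_zpow {ρ n : ℕ} (U : Matrix (Fin ρ) (Fin n) ℤ) (g : G) (w : Fin n → ℤ)
    (i : Fin ρ) : monomialMap U (fun j => g ^ w j) i = g ^ U.mulVec w i := by
  rw [monomialMap_apply, Matrix.mulVec, dotProduct, ← prod_zpow_eq_zpow_sum]
  exact Finset.prod_congr rfl fun j _ => by rw [mul_comm, zpow_mul]

end MonomialMap

/-- The number of points of a finite group whose image satisfies a predicate. -/
theorem MonoidHom.card_subtype_comp {A B : Type*} [Group A] [Group B] [Finite A] [Finite B]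
    (f : A →* B) (C : B → Prop) :
    Nat.card {x // C (f x)} = Nat.card {u // C u ∧ u ∈ f.range} * Nat.card f.ker := by
  rw [← Nat.card_prod]
  have hmem (u : {u // C u ∧ u ∈ f.range}) : ∃ x, f x = u.1 := u.2.2
  choose t ht using hmem
  have ht' (x : {x // C (f x)}) : f (t ⟨f x.1, x.2, x.1, rfl⟩) = f x.1 := ht _
  refine Nat.card_congr
    { toFun := fun x => (⟨f x.1, x.2, x.1, rfl⟩,
        ⟨(t ⟨f x.1, x.2, x.1, rfl⟩)⁻¹ * x.1, by
          rw [MonoidHom.mem_ker, map_mul, map_inv, ht', inv_mul_cancel]⟩)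
      invFun := fun p => ⟨t p.1 * p.2.1, by
        rw [map_mul, ht, MonoidHom.mem_ker.1 p.2.2, mul_one]; exact p.1.2.1⟩
      left_inv := fun x => by simp
      right_inv := ?_ }
  rintro ⟨u, k⟩
  have hu : f (t u * k.1) = u.1 := by rw [map_mul, ht, MonoidHom.mem_ker.1 k.2, mul_one]
  have h : (⟨f (t u * k.1), by rw [hu]; exact u.2.1, _, rfl⟩ : {u // C u ∧ u ∈ f.range}) = u :=
    Subtype.ext hu
  ext1
  · exact h
  · apply Subtype.ext
    change (t ⟨f (t u * k.1), _⟩)⁻¹ * (t u * k.1) = k.1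
    rw [h, inv_mul_cancel_left]

/-- In a finite cyclic group, the `d`-th powers are the elements whose index is divisible by
`gcd (#G) d`. -/
theorem exists_pow_eq_zpow_iff {G : Type*} [CommGroup G] [Finite G] {g : G}
    (hg : ∀ x, x ∈ Subgroup.zpowers g) (d : ℕ) (h : ℤ) :
    (∃ y, y ^ d = g ^ h) ↔ (Nat.gcd (Nat.card G) d : ℤ) ∣ h := by
  have hcard : Nat.card G = orderOf g := (orderOf_eq_card_of_forall_mem_zpowers hg).symm
  constructor
  · rintro ⟨y, hy⟩
    obtain ⟨k, rfl⟩ := hg y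
    dsimp only at hy
    rw [← zpow_natCast, ← zpow_mul, zpow_eq_zpow_iff_modEq, ← hcard] at hy
    have h1 := (Int.natCast_dvd_natCast.2 (Nat.gcd_dvd_left (Nat.card G) d)).trans hy.dvd
    have h2 : (Nat.gcd (Nat.card G) d : ℤ) ∣ k * d :=
      (Int.natCast_dvd_natCast.2 (Nat.gcd_dvd_right (Nat.card G) d)).mul_left k
    simpa using dvd_add h1 h2
  · rintro ⟨c, rfl⟩
    refine ⟨g ^ (Nat.gcdB (Nat.card G) d * c), ?_⟩
    rw [← zpow_natCast, ← zpow_mul, zpow_eq_zpow_iff_modEq, ← hcard, Nat.gcd_eq_gcd_ab]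
    exact Int.modEq_iff_dvd.2 ⟨Nat.gcdA (Nat.card G) d * c, by ring⟩

namespace IsSmithDatum

variable {ρ n s : ℕ} {M : Matrix (Fin ρ) (Fin n) ℤ} {U : Matrix (Fin ρ) (Fin ρ) ℤ}
  {V : Matrix (Fin n) (Fin n) ℤ} {d : ℕ → ℕ}

/-- The number of invariant factors is at most the number of possibly nonzero columns. -/
theorem le_of_forall_eq_zero (h : IsSmithDatum M U V s d) {a : ℕ}
    (ha : ∀ i (j : Fin n), a ≤ j → M i j = 0) : s ≤ a := by
  obtain ⟨-, -, hsρ, hsn, hd, -, hD⟩ := h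
  by_cases han : n ≤ a
  · exact hsn.trans han
  replace han : a ≤ n := by omega
  let f : (Fin s → ℤ) →ₗ[ℤ] (Fin a → ℤ) := Matrix.vecMulLinear
    (Matrix.of fun (i : Fin s) (k : Fin a) => (U * M) (i.castLE hsρ) (k.castLE han))
  have hf : Function.Injective f := by
    rw [injective_iff_map_eq_zero]
    intro w hw
    have hcol (k : Fin n) : ∑ i : Fin s, w i * (U * M) (i.castLE hsρ) k = 0 := by
      by_cases hk : (k : ℕ) < a
      · exact congrFun hw ⟨k, hk⟩
      · refine Finset.sum_eq_zero fun i _ => ?_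
        rw [Matrix.mul_apply, Finset.sum_eq_zero, mul_zero]
        intro l _
        rw [ha l k (by omega), mul_zero]
    ext k
    have h1 : ∑ i : Fin s, w i * (U * M * V) (i.castLE hsρ) (k.castLE hsn) = 0 := by
      simp only [Matrix.mul_apply (M := U * M), Finset.mul_sum, ← mul_assoc]
      rw [Finset.sum_comm]
      simp only [← Finset.sum_mul, hcol, zero_mul, Finset.sum_const_zero]
    rw [Finset.sum_eq_single k] at h1
    · rw [hD] at h1
      have := hd k k.2
      simp only [Fin.val_castLE, k.2, and_self, if_true, mul_eq_zero] at h1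
      rcases h1 with h1 | h1
      · exact h1
      · omega
    · intro i _ hik
      rw [hD, if_neg, mul_zero]
      simpa [Fin.ext_iff] using hik
    · simp
  simpa using card_le_of_injective ℤ f hf

variable {G : Type*} [CommGroup G]

theorem monomialMap_apply (h : IsSmithDatum M U V s d) (y : Fin n → G) (i : Fin ρ) :
    monomialMap (U * M * V) y i =
      if hi : (i : ℕ) < s then y ⟨i, hi.trans_le h.2.2.2.1⟩ ^ d i else 1 := by
  obtain ⟨-, -, -, hsn, -, -, hD⟩ := h
  rw [_root_.monomialMap_apply]
  split_ifs with hi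
  · rw [Finset.prod_eq_single ⟨i, hi.trans_le hsn⟩]
    · simp [hD, hi]
    · intro j _ hj
      rw [hD, if_neg, zpow_zero]
      rintro ⟨hij, -⟩
      exact hj (Fin.ext hij.symm)
    · simp
  · refine Finset.prod_eq_one fun j _ => ?_
    rw [hD, if_neg (fun h => hi h.2), zpow_zero]

theorem mem_range_iff (h : IsSmithDatum M U V s d) (z : Fin ρ → G) :
    z ∈ (monomialMap (U * M * V)).range ↔
      ∀ i : Fin ρ, ∃ y, y ^ (if (i : ℕ) < s then d i else 0) = z i := by
  obtain ⟨hsρ, hsn⟩ : s ≤ ρ ∧ s ≤ n := ⟨h.2.2.1, h.2.2.2.1⟩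
  constructor
  · rintro ⟨y, rfl⟩ i
    rw [h.monomialMap_apply]
    split_ifs with hi
    · exact ⟨_, rfl⟩
    · exact ⟨1, pow_zero _⟩
  · intro hz
    choose y hy using hz
    refine ⟨fun j => if hj : (j : ℕ) < s then y ⟨j, hj.trans_le hsρ⟩ else 1, ?_⟩
    ext i
    rw [h.monomialMap_apply, ← hy i]
    split_ifs with hi
    · simp
    · rw [pow_zero]

theorem card_ker [Finite G] [IsCyclic G] (h : IsSmithDatum M U V s d) :
    Nat.card (monomialMap (G := G) (U * M * V)).ker =
      Nat.card G ^ (n - s) * ∏ j ∈ Finset.range s, Nat.gcd (Nat.card G) (d j) := by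
  obtain ⟨hsρ, hsn⟩ : s ≤ ρ ∧ s ≤ n := ⟨h.2.2.1, h.2.2.2.1⟩
  let e : ℕ → ℕ := fun j => if j < s then d j else 0
  have hker (y : Fin n → G) :
      y ∈ (monomialMap (G := G) (U * M * V)).ker ↔
        ∀ j : Fin n, y j ∈ (powMonoidHom (e j) : G →* G).ker := by
    simp only [MonoidHom.mem_ker, funext_iff, h.monomialMap_apply, powMonoidHom_apply, e]
    constructor
    · intro hy j
      split_ifs with hj
      · simpa [hj] using hy ⟨j, hj.trans_le hsρ⟩
      · rw [pow_zero]
    · intro hy i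
      split_ifs with hi
      · simpa [hi] using hy ⟨i, hi.trans_le hsn⟩
      · rfl
  have e1 : (monomialMap (G := G) (U * M * V)).ker ≃
      ((j : Fin n) → (powMonoidHom (e j) : G →* G).ker) :=
    (Equiv.subtypeEquivRight hker).trans
      (Equiv.subtypePiEquivPi (p := fun (j : Fin n) y => y ∈ (powMonoidHom (e j) : G →* G).ker))
  rw [Nat.card_congr e1, Nat.card_pi]
  simp only [IsCyclic.card_powMonoidHom_ker]
  rw [Fin.prod_univ_eq_prod_range (fun j => Nat.gcd (Nat.card G) (e j)) n]
  conv_lhs => rw [← Nat.add_sub_cancel' hsn, Finset.prod_range_add]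
  rw [mul_comm]
  congr 1
  · simp [e]
  · exact Finset.prod_congr rfl fun j hj => by simp [e, Finset.mem_range.1 hj]

/-- The number of tuples whose monomials satisfy a given predicate. -/
theorem card_monomialMap [Finite G] (h : IsSmithDatum M U V s d) {g : G}
    (hg : ∀ x, x ∈ Subgroup.zpowers g) {ind : G → ℕ} (hind : ∀ x, g ^ ind x = x)
    (C : (Fin ρ → G) → Prop) :
    Nat.card {x : Fin n → G // C (monomialMap M x)} =
      Nat.card {u : Fin ρ → G // C u ∧ IndexCond (Nat.card G) U s d fun i => (ind (u i) : ℤ)} *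
        Nat.card G ^ (n - s) * ∏ j ∈ Finset.range s, Nat.gcd (Nat.card G) (d j) := by
  have : IsCyclic G := ⟨g, hg⟩
  obtain ⟨hU, hV⟩ : IsUnit U.det ∧ IsUnit V.det := ⟨h.1, h.2.1⟩
  have hx (y : Fin n → G) : monomialMap M (monomialEquiv V hV y) =
      (monomialEquiv U hU).symm (monomialMap (U * M * V) y) := by
    rw [Equiv.eq_symm_apply, monomialEquiv_apply, monomialEquiv_apply, ← monomialMap_mul,
      ← monomialMap_mul, Matrix.mul_assoc]
  have hu (u : Fin ρ → G) : IndexCond (Nat.card G) U s d (fun i => (ind (u i) : ℤ)) ↔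
      monomialEquiv U hU u ∈ (monomialMap (G := G) (U * M * V)).range := by
    rw [h.mem_range_iff]
    refine forall_congr' fun i => ?_
    have hz : monomialEquiv U hU u i = g ^ U.mulVec (fun i => (ind (u i) : ℤ)) i := by
      rw [← monomialMap_zpow, monomialEquiv_apply]
      simp only [zpow_natCast, hind]
    rw [hz, exists_pow_eq_zpow_iff hg]
    split_ifs <;> simp
  rw [Nat.card_congr ((monomialEquiv V hV).subtypeEquiv
      (p := fun y => C ((monomialEquiv U hU).symm (monomialMap (U * M * V) y)))
      fun y => by rw [hx]).symm,
    MonoidHom.card_subtype_comp _ (fun z => C ((monomialEquiv U hU).symm z)), h.card_ker,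
    mul_assoc]
  congr 1
  refine (Nat.card_congr ((monomialEquiv U hU).subtypeEquiv fun u => ?_)).symm
  rw [hu, Equiv.symm_apply_apply]

end IsSmithDatum

section Strata

variable {F : Type*} [Field F] {n : ℕ}

/-- Exchanging the coordinate `b` with a new one. -/
theorem card_nonzero_succ [Fintype F] (T : (Fin n → F) → Prop) {a b : ℕ} (hab : a ≤ b) (hbn : b < n)
    (hT : ∀ x y : Fin n → F, (∀ j : Fin n, (j : ℕ) < a → x j = y j) → (T x ↔ T y)) :
    Nat.card {x // T x ∧ ∀ j : Fin n, (j : ℕ) < b → x j ≠ 0} * (Fintype.card F - 1) =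
      Nat.card {x // T x ∧ ∀ j : Fin n, (j : ℕ) < b + 1 → x j ≠ 0} * Fintype.card F := by
  classical
  have hup (x : Fin n → F) (y : F) : T x → T (Function.update x ⟨b, hbn⟩ y) := by
    refine (hT _ _ fun j hj => ?_).1
    rw [Function.update_of_ne]
    rintro rfl
    simp at hj
    omega
  rw [← Fintype.card_units, ← Nat.card_eq_fintype_card, ← Nat.card_eq_fintype_card,
    ← Nat.card_prod, ← Nat.card_prod]
  refine Nat.card_congr
    { toFun := fun p => (⟨Function.update p.1.1 ⟨b, hbn⟩ p.2, hup _ _ p.1.2.1, ?_⟩,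
        p.1.1 ⟨b, hbn⟩)
      invFun := fun p => (⟨Function.update p.1.1 ⟨b, hbn⟩ p.2, hup _ _ p.1.2.1, ?_⟩,
        Units.mk0 (p.1.1 ⟨b, hbn⟩) (p.1.2.2 _ (Nat.lt_succ_self b)))
      left_inv := ?_
      right_inv := ?_ }
  · intro j hj
    by_cases h : j = ⟨b, hbn⟩
    · subst h
      simp
    · rw [Function.update_of_ne h]
      refine p.1.2.2 j ?_
      have : (j : ℕ) ≠ b := fun h' => h (Fin.ext h')
      omega
  · intro j hj
    rw [Function.update_of_ne]
    · exact p.1.2.2 j (by omega)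
    · rintro rfl
      simp at hj
  · rintro ⟨⟨x, hx⟩, u⟩
    simp
  · rintro ⟨⟨x, hx⟩, u⟩
    simp

theorem card_nonzero_top (T : (Fin n → F) → Prop) :
    Nat.card {x // T x ∧ ∀ j : Fin n, (j : ℕ) < n → x j ≠ 0} =
      Nat.card {x : Fin n → Fˣ // T fun j => (x j : F)} :=
  Nat.card_congr
    { toFun := fun x => ⟨fun j => Units.mk0 (x.1 j) (x.2.2 j j.2), x.2.1⟩
      invFun := fun x => ⟨fun j => x.1 j, x.2, fun j _ => (x.1 j).ne_zero⟩
      left_inv := fun _ => rfl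
      right_inv := fun _ => by ext; rfl }

theorem card_nonzero [Fintype F] (T : (Fin n → F) → Prop) {a L : ℕ}
    (hT : ∀ x y : Fin n → F, (∀ j : Fin n, (j : ℕ) < a → x j = y j) → (T x ↔ T y))
    (hL : Nat.card {x : Fin n → Fˣ // T fun j => (x j : F)} = L * (Fintype.card F - 1) ^ (n - a))
    {b : ℕ} (hab : a ≤ b) (hbn : b ≤ n) :
    Nat.card {x // T x ∧ ∀ j : Fin n, (j : ℕ) < b → x j ≠ 0} =
      Fintype.card F ^ (n - b) * (Fintype.card F - 1) ^ (b - a) * L := by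
  have hpos : 0 < Fintype.card F - 1 := Nat.sub_pos_of_lt Fintype.one_lt_card
  induction hbn using Nat.decreasingInduction with
  | self => rw [card_nonzero_top, hL, Nat.sub_self, pow_zero]; ring
  | @of_succ b hb ih =>
    refine Nat.eq_of_mul_eq_mul_right hpos ?_
    rw [card_nonzero_succ T hab hb hT, ih (by omega), show n - b = n - (b + 1) + 1 by omega,
      show b + 1 - a = b - a + 1 by omega]
    ring

/-- Splitting off the points whose first vanishing coordinate lies in `[a, b)`. -/
theorem card_nonzero_split [Fintype F] (S T : (Fin n → F) → Prop) {a b L : ℕ} (hab : a ≤ b) (hbn : b ≤ n)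
    (hT : ∀ x y : Fin n → F, (∀ j : Fin n, (j : ℕ) < a → x j = y j) → (T x ↔ T y))
    (hL : Nat.card {x : Fin n → Fˣ // T fun j => (x j : F)} = L * (Fintype.card F - 1) ^ (n - a))
    (hST : ∀ (x : Fin n → F) (j : Fin n), a ≤ (j : ℕ) → (j : ℕ) < b → x j = 0 → (S x ↔ T x)) :
    Nat.card {x // S x ∧ ∀ j : Fin n, (j : ℕ) < a → x j ≠ 0} =
      Fintype.card F ^ (n - b) *
          (Fintype.card F ^ (b - a) - (Fintype.card F - 1) ^ (b - a)) * L +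
        Nat.card {x // S x ∧ ∀ j : Fin n, (j : ℕ) < b → x j ≠ 0} := by
  classical
  have hsplit (P : (Fin n → F) → Prop) :
      Nat.card {x // P x ∧ ∀ j : Fin n, (j : ℕ) < a → x j ≠ 0} =
        Nat.card {x // P x ∧ (∀ j : Fin n, (j : ℕ) < a → x j ≠ 0) ∧
          ∃ j : Fin n, a ≤ (j : ℕ) ∧ (j : ℕ) < b ∧ x j = 0} +
        Nat.card {x // P x ∧ ∀ j : Fin n, (j : ℕ) < b → x j ≠ 0} := by
    simp only [Nat.card_eq_fintype_card, Fintype.card_subtype]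
    rw [← Finset.card_filter_add_card_filter_not (p := fun x : Fin n → F =>
      ∃ j : Fin n, a ≤ (j : ℕ) ∧ (j : ℕ) < b ∧ x j = 0), Finset.filter_filter,
      Finset.filter_filter]
    congr 2
    · ext x
      simp only [Finset.mem_filter, and_assoc]
    · ext x
      simp only [Finset.mem_filter, Finset.mem_univ, true_and, and_assoc, and_congr_right_iff]
      refine fun _ => ⟨fun h j hj => ?_, fun h => ⟨fun j hj => h j (by omega), ?_⟩⟩
      · by_cases hja : (j : ℕ) < a
        · exact h.1 j hja
        · exact fun h0 => h.2 ⟨j, by omega, hj, h0⟩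
      · rintro ⟨j, -, hj, h0⟩
        exact h j hj h0
  have hmid : Nat.card {x // S x ∧ (∀ j : Fin n, (j : ℕ) < a → x j ≠ 0) ∧
        ∃ j : Fin n, a ≤ (j : ℕ) ∧ (j : ℕ) < b ∧ x j = 0} =
      Nat.card {x // T x ∧ (∀ j : Fin n, (j : ℕ) < a → x j ≠ 0) ∧
        ∃ j : Fin n, a ≤ (j : ℕ) ∧ (j : ℕ) < b ∧ x j = 0} := by
    refine Nat.card_congr (Equiv.subtypeEquivRight fun x => and_congr_left ?_)
    rintro ⟨-, j, hja, hjb, h0⟩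
    exact hST x j hja hjb h0
  have hTs := hsplit T
  rw [card_nonzero T hT hL le_rfl (hab.trans hbn), card_nonzero T hT hL hab hbn] at hTs
  rw [hsplit S, hmid]
  congr 1
  rw [Nat.mul_sub, Nat.sub_mul, ← pow_add, show n - b + (b - a) = n - a by omega]
  rw [Nat.sub_self, pow_zero, mul_one] at hTs
  omega

/-- The system consisting of the first `p₁`, resp. `p₂`, terms of the two polynomials. -/
def TruncatedSystem (a₁ a₂ : ℕ → Fˣ) (E₁ E₂ : ℕ → ℕ → ℕ) (b₁ b₂ : F) (p₁ p₂ : ℕ)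
    (x : Fin n → F) : Prop :=
  (∑ i ∈ Finset.range p₁, (a₁ i : F) * ∏ j : Fin n, x j ^ E₁ i (j : ℕ)) = b₁ ∧
    (∑ i ∈ Finset.range p₂, (a₂ i : F) * ∏ j : Fin n, x j ^ E₂ i (j : ℕ)) = b₂

theorem sum_range_monomial_congr (c : ℕ → Fˣ) (E : ℕ → ℕ → ℕ) {p a : ℕ}
    (hE : ∀ i, i < p → ∀ j, a ≤ j → E i j = 0) {x y : Fin n → F}
    (hxy : ∀ j : Fin n, (j : ℕ) < a → x j = y j) :
    (∑ i ∈ Finset.range p, (c i : F) * ∏ j : Fin n, x j ^ E i (j : ℕ)) =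
      ∑ i ∈ Finset.range p, (c i : F) * ∏ j : Fin n, y j ^ E i (j : ℕ) := by
  refine Finset.sum_congr rfl fun i hi => ?_
  congr 1
  refine Finset.prod_congr rfl fun j _ => ?_
  by_cases hj : (j : ℕ) < a
  · rw [hxy j hj]
  · rw [hE i (Finset.mem_range.1 hi) j (by omega), pow_zero, pow_zero]

theorem sum_range_monomial_truncate (c : ℕ → Fˣ) (E : ℕ → ℕ → ℕ) {p r : ℕ} (hpr : p ≤ r)
    {x : Fin n → F} {j : Fin n} (hE : ∀ i, p ≤ i → i < r → 0 < E i j) (hx : x j = 0) :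
    (∑ i ∈ Finset.range r, (c i : F) * ∏ j : Fin n, x j ^ E i (j : ℕ)) =
      ∑ i ∈ Finset.range p, (c i : F) * ∏ j : Fin n, x j ^ E i (j : ℕ) := by
  refine (Finset.sum_subset (Finset.range_subset_range.2 hpr) fun i hi hi' => ?_).symm
  rw [Finset.mem_range] at hi hi'
  rw [Finset.prod_eq_zero (Finset.mem_univ j), mul_zero]
  rw [hx, zero_pow (hE i (by omega) hi).ne']

variable {a₁ a₂ : ℕ → Fˣ} {E₁ E₂ : ℕ → ℕ → ℕ} {b₁ b₂ : F}

theorem truncatedSystem_congr {p₁ p₂ a : ℕ} (h₁ : ∀ i, i < p₁ → ∀ j, a ≤ j → E₁ i j = 0)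
    (h₂ : ∀ i, i < p₂ → ∀ j, a ≤ j → E₂ i j = 0) (x y : Fin n → F)
    (hxy : ∀ j : Fin n, (j : ℕ) < a → x j = y j) :
    TruncatedSystem a₁ a₂ E₁ E₂ b₁ b₂ p₁ p₂ x ↔ TruncatedSystem a₁ a₂ E₁ E₂ b₁ b₂ p₁ p₂ y := by
  rw [TruncatedSystem, TruncatedSystem, sum_range_monomial_congr a₁ E₁ h₁ hxy,
    sum_range_monomial_congr a₂ E₂ h₂ hxy]

theorem truncatedSystem_iff {p₁ p₂ r₁ r₂ : ℕ} (hp₁ : p₁ ≤ r₁) (hp₂ : p₂ ≤ r₂) {x : Fin n → F}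
    {j : Fin n} (h₁ : ∀ i, p₁ ≤ i → i < r₁ → 0 < E₁ i j)
    (h₂ : ∀ i, p₂ ≤ i → i < r₂ → 0 < E₂ i j) (hx : x j = 0) :
    TruncatedSystem a₁ a₂ E₁ E₂ b₁ b₂ r₁ r₂ x ↔ TruncatedSystem a₁ a₂ E₁ E₂ b₁ b₂ p₁ p₂ x := by
  rw [TruncatedSystem, TruncatedSystem, sum_range_monomial_truncate a₁ E₁ hp₁ h₁ hx,
    sum_range_monomial_truncate a₂ E₂ hp₂ h₂ hx]

variable {α : Fˣ} {ind : Fˣ → ℕ}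

/-- Points of the torus on a system whose first equation alone involves monomials. -/
theorem card_torus_single [Fintype F] (hα : ∀ β, β ∈ Subgroup.zpowers α) (hind : ∀ β, α ^ ind β = β)
    {p a s : ℕ} {d : ℕ → ℕ} {U : Matrix (Fin p) (Fin p) ℤ} {V : Matrix (Fin n) (Fin n) ℤ}
    (hSD : IsSmithDatum (Matrix.of fun (i : Fin p) (j : Fin n) => (E₁ i j : ℤ)) U V s d)
    (han : a ≤ n) (h₁ : ∀ i, i < p → ∀ j, a ≤ j → E₁ i j = 0) :
    Nat.card {x : Fin n → Fˣ // TruncatedSystem a₁ a₂ E₁ E₂ b₁ 0 p 0 fun j => (x j : F)} =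
      Nat.card {u : Fin p → Fˣ // (∑ i : Fin p, (a₁ (i : ℕ) : F) * (u i : F)) = b₁ ∧
        IndexCond (Fintype.card F - 1) U s d fun i => (ind (u i) : ℤ)} *
      (Fintype.card F - 1) ^ (a - s) *
      (∏ j ∈ Finset.range s, Nat.gcd (Fintype.card F - 1) (d j)) *
      (Fintype.card F - 1) ^ (n - a) := by
  classical
  have hsa : s ≤ a := hSD.le_of_forall_eq_zero fun i j hj => by simp [h₁ i i.2 j hj]
  have hcard : Nat.card Fˣ = Fintype.card F - 1 := by
    rw [Nat.card_eq_fintype_card, Fintype.card_units]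
  have key := hSD.card_monomialMap hα hind fun u => (∑ i : Fin p, (a₁ (i : ℕ) : F) * (u i : F)) = b₁
  rw [hcard, show n - s = a - s + (n - a) by omega, pow_add] at key
  refine (Nat.card_congr (Equiv.subtypeEquivRight fun x => ?_)).trans (key.trans (by ring))
  simp [TruncatedSystem, monomialMap_apply, Finset.sum_range]

/-- Points of the torus on a truncated system. -/
theorem card_torus_stack [Fintype F] (hα : ∀ β, β ∈ Subgroup.zpowers α) (hind : ∀ β, α ^ ind β = β)
    {p₁ p₂ a s : ℕ} {d : ℕ → ℕ} {U : Matrix (Fin (p₁ + p₂)) (Fin (p₁ + p₂)) ℤ}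
    {V : Matrix (Fin n) (Fin n) ℤ} (hSD : IsSmithDatum (stackM E₁ E₂ p₁ p₂ n) U V s d)
    (han : a ≤ n) (h₁ : ∀ i, i < p₁ → ∀ j, a ≤ j → E₁ i j = 0)
    (h₂ : ∀ i, i < p₂ → ∀ j, a ≤ j → E₂ i j = 0) :
    Nat.card {x : Fin n → Fˣ // TruncatedSystem a₁ a₂ E₁ E₂ b₁ b₂ p₁ p₂ fun j => (x j : F)} =
      Nat.card {w : Fin (p₁ + p₂) → Fˣ //
        (∑ i : Fin (p₁ + p₂), if (i : ℕ) < p₁ then (a₁ (i : ℕ) : F) * (w i : F) else 0) = b₁ ∧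
        (∑ i : Fin (p₁ + p₂), if p₁ ≤ (i : ℕ) then (a₂ ((i : ℕ) - p₁) : F) * (w i : F) else 0)
          = b₂ ∧
        IndexCond (Fintype.card F - 1) U s d fun i => (ind (w i) : ℤ)} *
      (Fintype.card F - 1) ^ (a - s) *
      (∏ j ∈ Finset.range s, Nat.gcd (Fintype.card F - 1) (d j)) *
      (Fintype.card F - 1) ^ (n - a) := by
  classical
  have hsa : s ≤ a := hSD.le_of_forall_eq_zero fun i j hj => by
    by_cases hi : (i : ℕ) < p₁
    · simp [stackM, hi, h₁ i hi j hj]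
    · simp [stackM, hi, h₂ (i - p₁) (by omega) j hj]
  have hcard : Nat.card Fˣ = Fintype.card F - 1 := by
    rw [Nat.card_eq_fintype_card, Fintype.card_units]
  have key := hSD.card_monomialMap hα hind fun w =>
    (∑ i : Fin (p₁ + p₂), if (i : ℕ) < p₁ then (a₁ (i : ℕ) : F) * (w i : F) else 0) = b₁ ∧
    (∑ i : Fin (p₁ + p₂), if p₁ ≤ (i : ℕ) then (a₂ ((i : ℕ) - p₁) : F) * (w i : F) else 0) = b₂
  rw [hcard, show n - s = a - s + (n - a) by omega, pow_add] at key
  simp only [and_assoc] at key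
  refine (Nat.card_congr (Equiv.subtypeEquivRight fun x => ?_)).trans (key.trans (by ring))
  have hlt (i : Fin p₁) : ¬p₁ ≤ (i : ℕ) := by omega
  simp [TruncatedSystem, monomialMap_apply, Finset.sum_range, Fin.sum_univ_add, stackM, hlt]

theorem card_torus_const [Fintype F] (n : ℕ) : Nat.card {x : Fin n → Fˣ //
      TruncatedSystem a₁ a₂ E₁ E₂ 0 0 0 0 fun j => (x j : F)} = (Fintype.card F - 1) ^ n := by
  classical
  simp [TruncatedSystem, Fintype.card_units]

end Strata

theorem rational_points_case_n1_lt_n3_lt_n2_lt_n4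
    (F : Type) [Field F] [Fintype F] [DecidableEq F]
    (q : ℕ) (hq : q = Fintype.card F)
    (hqpow : ∃ p k : ℕ, Nat.Prime p ∧ Odd p ∧ 0 < k ∧ q = p ^ k)
    (α : Fˣ) (hα : ∀ β : Fˣ, β ∈ Subgroup.zpowers α)
    (ind : Fˣ → ℕ)
    (hind : ∀ β : Fˣ, 1 ≤ ind β ∧ ind β ≤ q - 1 ∧ α ^ ind β = β)
    (r₁ r₂ r₃ r₄ n₁ n₂ n₃ n₄ : ℕ)
    (hr₁ : 0 < r₁) (hr₁₂ : r₁ < r₂) (hr₃ : 0 < r₃) (hr₃₄ : r₃ < r₄)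
    (hn₁ : 0 < n₁) (hn₁₂ : n₁ < n₂) (hn₃ : 0 < n₃) (hn₃₄ : n₃ < n₄)
    (hn₁₃ : n₁ ≤ n₃)
    (b₁ b₂ : F) (a₁ a₂ : ℕ → Fˣ)
    (E₁ E₂ : ℕ → ℕ → ℕ)
    (hE₁p : ∀ i, i < r₁ → ∀ j, j < n₁ → 0 < E₁ i j)
    (hE₁z : ∀ i, i < r₁ → ∀ j, n₁ ≤ j → E₁ i j = 0)
    (hE₁p' : ∀ i, r₁ ≤ i → i < r₂ → ∀ j, j < n₂ → 0 < E₁ i j)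
    (hE₁z' : ∀ i, r₁ ≤ i → i < r₂ → ∀ j, n₂ ≤ j → E₁ i j = 0)
    (hE₂p : ∀ i, i < r₃ → ∀ j, j < n₃ → 0 < E₂ i j)
    (hE₂z : ∀ i, i < r₃ → ∀ j, n₃ ≤ j → E₂ i j = 0)
    (hE₂p' : ∀ i, r₃ ≤ i → i < r₄ → ∀ j, j < n₄ → 0 < E₂ i j)
    (hE₂z' : ∀ i, r₃ ≤ i → i < r₄ → ∀ j, n₄ ≤ j → E₂ i j = 0)
    (h₁₃ : n₁ < n₃) (h₃₂ : n₃ < n₂) (h₂₄ : n₂ < n₄)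
    (U₁ : Matrix (Fin (r₁)) (Fin (r₁)) ℤ) (V₁ : Matrix (Fin (n₄)) (Fin (n₄)) ℤ)
    (s₁ : ℕ) (d₁ : ℕ → ℕ)
    (hSD₁ : IsSmithDatum ((Matrix.of fun (i : Fin (r₁)) (j : Fin (n₄)) => (E₁ (i : ℕ) (j : ℕ) : ℤ))) U₁ V₁ s₁ d₁)
    (U₃ : Matrix (Fin (r₁ + r₃)) (Fin (r₁ + r₃)) ℤ) (V₃ : Matrix (Fin (n₄)) (Fin (n₄)) ℤ)
    (s₃ : ℕ) (d₃ : ℕ → ℕ)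
    (hSD₃ : IsSmithDatum (stackM E₁ E₂ r₁ r₃ n₄) U₃ V₃ s₃ d₃)
    (U₂ : Matrix (Fin (r₂ + r₃)) (Fin (r₂ + r₃)) ℤ) (V₂ : Matrix (Fin (n₄)) (Fin (n₄)) ℤ)
    (s₂ : ℕ) (d₂ : ℕ → ℕ)
    (hSD₂ : IsSmithDatum (stackM E₁ E₂ r₂ r₃ n₄) U₂ V₂ s₂ d₂)
    (U₄ : Matrix (Fin (r₂ + r₄)) (Fin (r₂ + r₄)) ℤ) (V₄ : Matrix (Fin (n₄)) (Fin (n₄)) ℤ)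
    (s₄ : ℕ) (d₄ : ℕ → ℕ)
    (hSD₄ : IsSmithDatum (stackM E₁ E₂ r₂ r₄ n₄) U₄ V₄ s₄ d₄)
    (H₁ : ℕ)
    (hH₁ : H₁ = Nat.card {u : Fin (r₁) → Fˣ //
      (∑ i : Fin (r₁), (a₁ (i : ℕ) : F) * ((u i : F))) = b₁ ∧
      IndexCond (q - 1) U₁ s₁ d₁ fun i => (ind (u i) : ℤ)})
    (H₃ : ℕ)
    (hH₃ : H₃ = Nat.card {w : Fin (r₁ + r₃) → Fˣ //
      (∑ i : Fin (r₁ + r₃), if (i : ℕ) < r₁ then (a₁ (i : ℕ) : F) * ((w i : F)) else 0) = b₁ ∧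
      (∑ i : Fin (r₁ + r₃), if r₁ ≤ (i : ℕ) then (a₂ ((i : ℕ) - r₁) : F) * ((w i : F)) else 0) = b₂ ∧
      IndexCond (q - 1) U₃ s₃ d₃ fun i => (ind (w i) : ℤ)})
    (H₂ : ℕ)
    (hH₂ : H₂ = Nat.card {w : Fin (r₂ + r₃) → Fˣ //
      (∑ i : Fin (r₂ + r₃), if (i : ℕ) < r₂ then (a₁ (i : ℕ) : F) * ((w i : F)) else 0) = b₁ ∧
      (∑ i : Fin (r₂ + r₃), if r₂ ≤ (i : ℕ) then (a₂ ((i : ℕ) - r₂) : F) * ((w i : F)) else 0) = b₂ ∧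
      IndexCond (q - 1) U₂ s₂ d₂ fun i => (ind (w i) : ℤ)})
    (H₄ : ℕ)
    (hH₄ : H₄ = Nat.card {w : Fin (r₂ + r₄) → Fˣ //
      (∑ i : Fin (r₂ + r₄), if (i : ℕ) < r₂ then (a₁ (i : ℕ) : F) * ((w i : F)) else 0) = b₁ ∧
      (∑ i : Fin (r₂ + r₄), if r₂ ≤ (i : ℕ) then (a₂ ((i : ℕ) - r₂) : F) * ((w i : F)) else 0) = b₂ ∧
      IndexCond (q - 1) U₄ s₄ d₄ fun i => (ind (w i) : ℤ)})
    (L₁ : ℕ)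
    (hL₁ : L₁ = H₁ * (q - 1) ^ (n₁ - s₁) * ∏ j ∈ Finset.range s₁, Nat.gcd (q - 1) (d₁ j))
    (L₂ : ℕ)
    (hL₂ : L₂ = H₂ * (q - 1) ^ (n₂ - s₂) * ∏ j ∈ Finset.range s₂, Nat.gcd (q - 1) (d₂ j))
    (L₃ : ℕ)
    (hL₃ : L₃ = H₃ * (q - 1) ^ (n₃ - s₃) * ∏ j ∈ Finset.range s₃, Nat.gcd (q - 1) (d₃ j))
    (L₄ : ℕ)
    (hL₄ : L₄ = H₄ * (q - 1) ^ (n₄ - s₄) * ∏ j ∈ Finset.range s₄, Nat.gcd (q - 1) (d₄ j))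
    :
    Nat.card {x : Fin (n₄) → F //
      (∑ i ∈ Finset.range r₂, (a₁ i : F) * ∏ j : Fin (n₄), x j ^ E₁ i (j : ℕ)) = b₁ ∧
      (∑ i ∈ Finset.range r₄, (a₂ i : F) * ∏ j : Fin (n₄), x j ^ E₂ i (j : ℕ)) = b₂} =
      (if b₁ = 0 ∧ b₂ = 0 then q ^ (n₄ - n₁) * (q ^ n₁ - (q - 1) ^ n₁) else 0) +
      (if b₂ = 0 then q ^ (n₄ - n₃) * (q ^ (n₃ - n₁) - (q - 1) ^ (n₃ - n₁)) * L₁ else 0) +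
      q ^ (n₄ - n₂) * (q ^ (n₂ - n₃) - (q - 1) ^ (n₂ - n₃)) * L₃ +
      (q ^ (n₄ - n₂) - (q - 1) ^ (n₄ - n₂)) * L₂ +
      L₄ := by
  subst hq
  have hind' (β : Fˣ) : α ^ ind β = β := (hind β).2.2
  have hE₁z₂ : ∀ i, i < r₂ → ∀ j, n₂ ≤ j → E₁ i j = 0 := fun i hi j hj => by
    rcases lt_or_ge i r₁ with h | h
    · exact hE₁z i h j (by omega)
    · exact hE₁z' i h hi j hj
  have hE₂z₄ : ∀ i, i < r₄ → ∀ j, n₄ ≤ j → E₂ i j = 0 := fun i hi j hj => by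
    rcases lt_or_ge i r₃ with h | h
    · exact hE₂z i h j (by omega)
    · exact hE₂z' i h hi j hj
  have hE₁pos : ∀ i, i < r₂ → ∀ j, j < n₁ → 0 < E₁ i j := fun i hi j hj => by
    rcases lt_or_ge i r₁ with h | h
    · exact hE₁p i h j hj
    · exact hE₁p' i h hi j (by omega)
  have hE₂pos : ∀ i, i < r₄ → ∀ j, j < n₃ → 0 < E₂ i j := fun i hi j hj => by
    rcases lt_or_ge i r₃ with h | h
    · exact hE₂p i h j hj
    · exact hE₂p' i h hi j (by omega)
  let S := TruncatedSystem (n := n₄) a₁ a₂ E₁ E₂ b₁ b₂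
  have hN₀ := card_nonzero_split (S r₂ r₄) (S 0 0) (a := 0) (b := n₁)
    (L := if b₁ = 0 ∧ b₂ = 0 then 1 else 0) (by omega) (by omega)
    (truncatedSystem_congr (by simp) (by simp))
    (by
      split_ifs with h
      · obtain ⟨rfl, rfl⟩ := h
        simpa using card_torus_const n₄
      · rw [zero_mul, Nat.card_eq_zero]
        exact Or.inl ⟨fun x => h ⟨by simpa using x.2.1.symm, by simpa using x.2.2.symm⟩⟩)
    (fun x j _ hj hx => truncatedSystem_iff (by omega) (by omega)
      (fun i _ hi => hE₁pos i hi j hj) (fun i _ hi => hE₂pos i hi j (by omega)) hx)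
  have hN₁ := card_nonzero_split (S r₂ r₄) (S r₁ 0) (a := n₁) (b := n₃)
    (L := if b₂ = 0 then L₁ else 0) (by omega) (by omega)
    (truncatedSystem_congr hE₁z (by simp))
    (by
      split_ifs with h
      · subst h
        rw [hL₁, hH₁]
        exact card_torus_single hα hind' hSD₁ (by omega) hE₁z
      · rw [zero_mul, Nat.card_eq_zero]
        exact Or.inl ⟨fun x => h (by simpa using x.2.2.symm)⟩)
    (fun x j _ hj hx => truncatedSystem_iff (by omega) (by omega)
      (fun i h hi => hE₁p' i h hi j (by omega)) (fun i _ hi => hE₂pos i hi j hj) hx)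
  have hN₂ := card_nonzero_split (S r₂ r₄) (S r₁ r₃) (a := n₃) (b := n₂)
    (L := L₃) (by omega) (by omega)
    (truncatedSystem_congr (fun i hi j hj => hE₁z i hi j (by omega)) hE₂z)
    (by
      rw [hL₃, hH₃]
      exact card_torus_stack hα hind' hSD₃ (by omega)
        (fun i hi j hj => hE₁z i hi j (by omega)) hE₂z)
    (fun x j _ hj hx => truncatedSystem_iff (by omega) (by omega)
      (fun i h hi => hE₁p' i h hi j hj) (fun i h hi => hE₂p' i h hi j (by omega)) hx)
  have hN₃ := card_nonzero_split (S r₂ r₄) (S r₂ r₃) (a := n₂) (b := n₄)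
    (L := L₂) (by omega) (by omega)
    (truncatedSystem_congr hE₁z₂ (fun i hi j hj => hE₂z i hi j (by omega)))
    (by
      rw [hL₂, hH₂]
      exact card_torus_stack hα hind' hSD₂ (by omega) hE₁z₂
        (fun i hi j hj => hE₂z i hi j (by omega)))
    (fun x j _ hj hx => truncatedSystem_iff (by omega) (by omega)
      (fun i h hi => absurd hi (by omega)) (fun i h hi => hE₂p' i h hi j hj) hx)
  have hN₄ : Nat.card {x : Fin n₄ → F // S r₂ r₄ x ∧ ∀ j : Fin n₄, (j : ℕ) < n₄ → x j ≠ 0} =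
      L₄ := by
    rw [card_nonzero_top, hL₄, hH₄]
    refine (card_torus_stack hα hind' hSD₄ le_rfl
      (fun i hi j hj => hE₁z₂ i hi j (by omega)) hE₂z₄).trans ?_
    rw [Nat.sub_self n₄, pow_zero, mul_one]
  have hstart : Nat.card {x : Fin n₄ → F // S r₂ r₄ x} =
      Nat.card {x : Fin n₄ → F // S r₂ r₄ x ∧ ∀ j : Fin n₄, (j : ℕ) < 0 → x j ≠ 0} := by
    simp
  refine hstart.trans ?_
  rw [hN₀, hN₁, hN₂, hN₃, hN₄]
  simp only [Nat.sub_self, Nat.sub_zero, pow_zero, one_mul, mul_ite, mul_one, mul_zero]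
  ring
end

section
/- Assume n_2 = n_3 (so n_1 < n_2 = n_3 < n_4 and n = n_4). Fix a Smith datum (U^{(1)}, V^{(1)}, d^{(1)}_1 | … | d^{(1)}_{s_1}) for E_{11}, a Smith datum (U^{(3)}, V^{(3)}, d^{(3)}_1 | … | d^{(3)}_{s_3}) for (E_{11}; E_{12}; E_{21}), and a Smith datum (U^{(4)}, V^{(4)}, d^{(4)}_1 | … | d^{(4)}_{s_4}) for (E_{11}; E_{12}; E_{21}; E_{22}). Define H_1 = #{(u_1,…,u_{r_1}) ∈ (F_q^*)^{r_1} : Σ_{i=1}^{r_1} a_{1,i} u_i = b_1 and u satisfies the index condition for (E_{11}, U^{(1)}, d^{(1)})}; H_3 = #{(u_1,…,u_{r_2}, v_1,…,v_{r_3}) ∈ (F_q^*)^{r_2+r_3} : Σ_{i=1}^{r_2} a_{1,i} u_i = b_1, Σ_{j=1}^{r_3} a_{2,j} v_j = b_2, and (u,v) satisfies the index condition for ((E_{11}; E_{12}; E_{21}), U^{(3)}, d^{(3)})}; H_4 = #{(u_1,…,u_{r_2}, v_1,…,v_{r_4}) ∈ (F_q^*)^{r_2+r_4} : Σ_{i=1}^{r_2}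 a_{1,i} u_i = b_1, Σ_{j=1}^{r_4} a_{2,j} v_j = b_2, and (u,v) satisfies the index condition for ((E_{11}; E_{12}; E_{21}; E_{22}), U^{(4)}, d^{(4)})}; and for l = 1,3,4 set L_l = H_l · (q−1)^{n_l − s_l} · ∏_{j=1}^{s_l} gcd(q−1, d^{(l)}_j). Then N = N_0 + N_1 + N_3 + N_4, where N_0 = q^{n_4−n_1}(q^{n_1} − (q−1)^{n_1}) if b_1 = b_2 = 0 and N_0 = 0 otherwise; N_1 = q^{n_4−n_2}(q^{n_2−n_1} − (q−1)^{n_2−n_1}) L_1 if b_2 = 0 and N_1 = 0 otherwise; N_3 = (q^{n_4−n_3} − (q−1)^{n_4−n_3}) L_3; and N_4 = L_4. -/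
open Finset

theorem ZMod.exists_natCast_mul_eq_intCast_iff (m d : ℕ) (h : ℤ) :
    (∃ y : ZMod m, (d : ZMod m) * y = (h : ZMod m)) ↔ ((Nat.gcd m d : ℕ) : ℤ) ∣ h := by
  constructor
  · rintro ⟨y, hy⟩
    obtain ⟨k, rfl⟩ := ZMod.intCast_surjective y
    have hm : (m : ℤ) ∣ h - d * k := by
      rw [← ZMod.intCast_eq_intCast_iff_dvd_sub]
      push_cast
      exact hy
    have h₁ : ((Nat.gcd m d : ℕ) : ℤ) ∣ h - d * k :=
      (Int.natCast_dvd_natCast.2 (Nat.gcd_dvd_left m d)).trans hm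
    have h₂ : ((Nat.gcd m d : ℕ) : ℤ) ∣ d * k :=
      (Int.natCast_dvd_natCast.2 (Nat.gcd_dvd_right m d)).mul_right k
    simpa using dvd_add h₁ h₂
  · rintro ⟨c, rfl⟩
    refine ⟨((Nat.gcdB m d * c : ℤ) : ZMod m), ?_⟩
    rw [Nat.gcd_eq_gcd_ab]
    push_cast
    rw [ZMod.natCast_self]
    ring

theorem ZMod.card_natCast_mul_eq_intCast (m d : ℕ) [NeZero m] (h : ℤ)
    (hd : ((Nat.gcd m d : ℕ) : ℤ) ∣ h) :
    Nat.card {y : ZMod m // (d : ZMod m) * y = (h : ZMod m)} = Nat.gcd m d := by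
  obtain ⟨y₀, hy₀⟩ := (ZMod.exists_natCast_mul_eq_intCast_iff m d h).2 hd
  have hker := IsAddCyclic.card_nsmulAddMonoidHom_ker (ZMod m) d
  rw [Nat.card_zmod] at hker
  rw [← hker]
  refine Nat.card_congr (Equiv.subtypeEquiv (Equiv.subRight y₀) fun y => ?_)
  simp [AddMonoidHom.mem_ker, mul_sub, hy₀, sub_eq_zero]

/-- The number of solutions of a diagonal linear system over `ZMod m`. -/
theorem ZMod.card_pi_natCast_mul_eq_intCast (m n : ℕ) [NeZero m] (d : Fin n → ℕ)
    (h : Fin n → ℤ) (hd : ∀ j, ((Nat.gcd m (d j) : ℕ) : ℤ) ∣ h j) :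
    Nat.card {y : Fin n → ZMod m // ∀ j, (d j : ZMod m) * y j = (h j : ZMod m)} =
      ∏ j, Nat.gcd m (d j) := by
  rw [Nat.card_congr (Equiv.subtypePiEquivPi
    (p := fun j (z : ZMod m) => (d j : ZMod m) * z = (h j : ZMod m))), Nat.card_pi]
  exact Finset.prod_congr rfl fun j _ => ZMod.card_natCast_mul_eq_intCast m (d j) (h j) (hd j)

theorem prod_gcd_truncated (m n s : ℕ) (hs : s ≤ n) (d : ℕ → ℕ) :
    ∏ j : Fin n, Nat.gcd m (if (j : ℕ) < s then d j else 0) =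
      m ^ (n - s) * ∏ j ∈ Finset.range s, Nat.gcd m (d j) := by
  obtain ⟨t, rfl⟩ := Nat.exists_eq_add_of_le hs
  rw [Fin.prod_univ_add, Finset.prod_range]
  simp [mul_comm]

/-- The number of solutions of `M *ᵥ y = w` over `ZMod m`, in terms of a Smith datum of `M`. -/
theorem IsSmithDatum.card_mulVec_eq {ρ n : ℕ} {M : Matrix (Fin ρ) (Fin n) ℤ}
    {U : Matrix (Fin ρ) (Fin ρ) ℤ} {V : Matrix (Fin n) (Fin n) ℤ} {s : ℕ} {d : ℕ → ℕ}
    (hM : IsSmithDatum M U V s d) (m : ℕ) [NeZero m] (w : Fin ρ → ℤ)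
    [Decidable (IndexCond m U s d w)] :
    Nat.card {y : Fin n → ZMod m //
        (M.map (Int.cast : ℤ → ZMod m)).mulVec y = fun i => (w i : ZMod m)} =
      if IndexCond m U s d w then
        m ^ (n - s) * ∏ j ∈ Finset.range s, Nat.gcd m (d j) else 0 := by
  obtain ⟨hU, hV, hsρ, hsn, -, -, hD⟩ := hM
  let φ := Int.castRingHom (ZMod m)
  have hU' : IsUnit (U.map φ) := ((Matrix.isUnit_iff_isUnit_det U).2 hU).map φ.mapMatrix
  have hV' : IsUnit (V.map φ) := ((Matrix.isUnit_iff_isUnit_det V).2 hV).map φ.mapMatrix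
  have key : ∀ y : Fin n → ZMod m,
      (M.map φ).mulVec ((V.map φ).mulVec y) = (fun i => (w i : ZMod m)) ↔
        ∀ i : Fin ρ, (if h : (i : ℕ) < s then (d i : ZMod m) * y ⟨i, h.trans_le hsn⟩ else 0) =
          ((U.mulVec w i : ℤ) : ZMod m) := by
    intro y
    rw [← (Matrix.mulVec_injective_of_isUnit hU').eq_iff, funext_iff]
    refine forall_congr' fun i => ?_
    have h₁ : (U.map φ).mulVec (fun i => (w i : ZMod m)) i = ((U.mulVec w i : ℤ) : ZMod m) :=
      (RingHom.map_mulVec φ U w i).symm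
    have h₂ : (U.map φ).mulVec ((M.map φ).mulVec ((V.map φ).mulVec y)) =
        ((U * M * V).map φ).mulVec y := by
      simp only [Matrix.map_mul, Matrix.mulVec_mulVec, Matrix.mul_assoc]
    rw [h₁, h₂]
    suffices h₃ : ((U * M * V).map φ).mulVec y i =
        if h : (i : ℕ) < s then (d i : ZMod m) * y ⟨i, h.trans_le hsn⟩ else 0 by rw [h₃]
    simp only [Matrix.mulVec, dotProduct, Matrix.map_apply, hD]
    split_ifs with h
    · rw [Finset.sum_eq_single ⟨i, h.trans_le hsn⟩]
      · simp [h, φ]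
      · intro j _ hj
        have : ¬ (i : ℕ) = j := fun hij => hj (Fin.ext hij.symm)
        simp [this]
      · simp
    · simp [h]
  have hbij : Function.Bijective (V.map φ).mulVec :=
    ⟨Matrix.mulVec_injective_of_isUnit hV', Matrix.mulVec_surjective_iff_isUnit.2 hV'⟩
  have hcard : Nat.card {y : Fin n → ZMod m //
        (M.map φ).mulVec y = fun i => (w i : ZMod m)} =
      Nat.card {y : Fin n → ZMod m // ∀ i : Fin ρ,
        (if h : (i : ℕ) < s then (d i : ZMod m) * y ⟨i, h.trans_le hsn⟩ else 0) =
          ((U.mulVec w i : ℤ) : ZMod m)} :=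
    (Nat.card_congr (Equiv.subtypeEquiv (Equiv.ofBijective _ hbij)
      fun y => (key y).symm)).symm
  refine hcard.trans ?_
  split_ifs with hI
  · have hI' : ∀ j : Fin n, ((Nat.gcd m (if (j : ℕ) < s then d j else 0) : ℕ) : ℤ) ∣
        if h : (j : ℕ) < s then U.mulVec w ⟨j, h.trans_le hsρ⟩ else 0 := by
      intro j
      by_cases h : (j : ℕ) < s
      · simpa [h] using hI ⟨j, h.trans_le hsρ⟩
      · simp [h]
    rw [← prod_gcd_truncated m n s hsn d, ← ZMod.card_pi_natCast_mul_eq_intCast m n _ _ hI']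
    refine Nat.card_congr (Equiv.subtypeEquivRight fun y => ⟨fun hy j => ?_, fun hy i => ?_⟩)
    · by_cases h : (j : ℕ) < s
      · simpa [h] using hy ⟨j, h.trans_le hsρ⟩
      · simp [h]
    · by_cases h : (i : ℕ) < s
      · simpa [h] using hy ⟨i, h.trans_le hsn⟩
      · have := hI i
        rw [if_neg h, ← ZMod.intCast_zmod_eq_zero_iff_dvd] at this
        simp [h, this]
  · rw [Nat.card_eq_zero]
    refine Or.inl ⟨fun ⟨y, hy⟩ => hI fun i => ?_⟩
    have := hy i
    split_ifs at this ⊢ with h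
    · exact (ZMod.exists_natCast_mul_eq_intCast_iff m (d i) _).1 ⟨_, this⟩
    · exact (ZMod.intCast_zmod_eq_zero_iff_dvd _ _).1 this.symm

/-- If the columns of `M` of index at least `n'` vanish, then `M` has at most `n'`
invariant factors. -/
theorem IsSmithDatum.le_of_columns_eq_zero {ρ n n' : ℕ} {M : Matrix (Fin ρ) (Fin n) ℤ}
    {U : Matrix (Fin ρ) (Fin ρ) ℤ} {V : Matrix (Fin n) (Fin n) ℤ} {s : ℕ} {d : ℕ → ℕ}
    (hM : IsSmithDatum M U V s d) (hn : n' ≤ n)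
    (hz : ∀ i (j : Fin n), n' ≤ (j : ℕ) → M i j = 0) : s ≤ n' := by
  obtain ⟨-, -, hsρ, hsn, hpos, -, hD⟩ := hM
  let f : (Fin s → ℤ) →ₗ[ℤ] (Fin n' → ℤ) :=
    LinearMap.funLeft ℤ ℤ (Fin.castLE hn) ∘ₗ V.mulVecLin ∘ₗ
      (Matrix.of fun (j : Fin n) (k : Fin s) => if (j : ℕ) = k then (1 : ℤ) else 0).mulVecLin
  have hf : Function.Injective f := by
    rw [← LinearMap.ker_eq_bot, LinearMap.ker_eq_bot']
    intro z hz0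
    set y := (Matrix.of fun (j : Fin n) (k : Fin s) =>
      if (j : ℕ) = k then (1 : ℤ) else 0).mulVec z with hy
    have hMV : M.mulVec (V.mulVec y) = 0 := by
      ext i
      change ∑ j, M i j * V.mulVec y j = 0
      refine Finset.sum_eq_zero fun j _ => ?_
      rcases lt_or_ge (j : ℕ) n' with hj | hj
      · have : V.mulVec y j = 0 := congrFun hz0 ⟨j, hj⟩
        rw [this, mul_zero]
      · rw [hz i j hj, zero_mul]
    have hDy : (U * M * V).mulVec y = 0 := by
      rw [← Matrix.mulVec_mulVec, ← Matrix.mulVec_mulVec, hMV, Matrix.mulVec_zero]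
    ext k
    have hk := congrFun hDy ⟨k, k.2.trans_le hsρ⟩
    have hyk : y ⟨k, k.2.trans_le hsn⟩ = z k := by
      simp only [hy, Matrix.mulVec, dotProduct, Matrix.of_apply, ite_mul, one_mul, zero_mul]
      simp [Fin.val_inj]
    simp only [Matrix.mulVec, dotProduct, hD] at hk
    rw [Finset.sum_eq_single ⟨k, k.2.trans_le hsn⟩] at hk
    · have hdk := hpos k k.2
      simpa [hyk, hdk.ne'] using hk
    · intro j _ hj
      have : ¬ (k : ℕ) = j := fun hkj => hj (Fin.ext hkj.symm)
      simp [this]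
    · simp
  simpa using card_le_of_injective ℤ f hf

theorem Nat.card_subtype_comp_eq_mul {X Y : Type*} [Finite X] [Finite Y] (g : X → Y)
    (P I : Y → Prop) (K : ℕ) (hI : ∀ x, I (g x))
    (hK : ∀ u, I u → Nat.card {x // g x = u} = K) :
    Nat.card {x // P (g x)} = Nat.card {u // P u ∧ I u} * K := by
  let e : {x // P (g x)} ≃ Σ u : {u // P u ∧ I u}, {x // g x = u} :=
    { toFun := fun x => ⟨⟨g x, x.2, hI x⟩, ⟨x, rfl⟩⟩
      invFun := fun p => ⟨p.2.1, by rw [p.2.2]; exact p.1.2.1⟩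
      left_inv := fun _ => rfl
      right_inv := by rintro ⟨⟨u, hu⟩, ⟨x, hx⟩⟩; obtain rfl : g x = u := hx; rfl }
  have := Fintype.ofFinite {u // P u ∧ I u}
  rw [Nat.card_congr e, Nat.card_sigma, Finset.sum_congr rfl fun u _ => hK u.1 u.2.2]
  simp [Nat.card_eq_fintype_card]

/-- The number of points of a split torus whose monomials satisfy a given condition, for a finite
cyclic group `G` with generator `α` and discrete logarithm `ind`. -/
theorem IsSmithDatum.card_monomials {G : Type*} [CommGroup G] [Finite G] {m : ℕ}
    (hm : m = Nat.card G) (α : G) (hα : ∀ β : G, β ∈ Subgroup.zpowers α) (ind : G → ℕ)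
    (hind : ∀ β : G, α ^ ind β = β) {ρ n : ℕ} {M : Matrix (Fin ρ) (Fin n) ℤ}
    {U : Matrix (Fin ρ) (Fin ρ) ℤ} {V : Matrix (Fin n) (Fin n) ℤ} {s : ℕ} {d : ℕ → ℕ}
    (hM : IsSmithDatum M U V s d) (E : Fin ρ → ℕ → ℕ) (hE : ∀ i j, M i j = E i (j : ℕ))
    (P : (Fin ρ → G) → Prop) :
    Nat.card {x : Fin n → G // P fun i => ∏ j : Fin n, x j ^ E i (j : ℕ)} =
      Nat.card {u : Fin ρ → G // P u ∧ IndexCond m U s d fun i => (ind (u i) : ℤ)} *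
        (m ^ (n - s) * ∏ j ∈ Finset.range s, Nat.gcd m (d j)) := by
  classical
  have hm0 : NeZero m := ⟨hm ▸ Nat.card_pos.ne'⟩
  have hord : orderOf α = m := by
    rw [hm, orderOf_eq_card_of_forall_mem_zpowers hα]
  have hinj : ∀ k l : ℕ, α ^ k = α ^ l ↔ (k : ZMod m) = l := by
    intro k l
    rw [pow_eq_pow_iff_modEq, hord, ZMod.natCast_eq_natCast_iff]
  let log : G ≃ ZMod m := Equiv.ofBijective (fun β => (ind β : ZMod m)) <| by
    constructor
    · intro β γ h
      rw [← hind β, ← hind γ]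
      exact (hinj _ _).2 h
    · intro z
      refine ⟨α ^ z.val, ?_⟩
      change ((ind (α ^ z.val) : ℕ) : ZMod m) = z
      rw [← ZMod.natCast_zmod_val z, ← hinj, hind, ZMod.natCast_zmod_val]
  have hlog : ∀ i (x : Fin n → G), log (∏ j : Fin n, x j ^ E i (j : ℕ)) =
      (M.map (Int.cast : ℤ → ZMod m)).mulVec (fun j => log (x j)) i := by
    intro i x
    have h : ∏ j : Fin n, x j ^ E i (j : ℕ) = α ^ ∑ j : Fin n, E i (j : ℕ) * ind (x j) := by
      rw [← Finset.prod_pow_eq_pow_sum]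
      refine Finset.prod_congr rfl fun j _ => ?_
      rw [mul_comm, pow_mul, hind]
    change ((ind (∏ j : Fin n, x j ^ E i (j : ℕ)) : ℕ) : ZMod m) =
      ∑ j, M.map (Int.cast : ℤ → ZMod m) i j * ((ind (x j) : ℕ) : ZMod m)
    rw [h, (hinj _ _).1 (hind (α ^ ∑ j : Fin n, E i (j : ℕ) * ind (x j)))]
    simp [hE]
  have hfiber : ∀ u : Fin ρ → G,
      Nat.card {x : Fin n → G // (fun i => ∏ j : Fin n, x j ^ E i (j : ℕ)) = u} =
        if IndexCond m U s d (fun i => (ind (u i) : ℤ)) then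
          m ^ (n - s) * ∏ j ∈ Finset.range s, Nat.gcd m (d j) else 0 := by
    intro u
    rw [← hM.card_mulVec_eq m fun i => (ind (u i) : ℤ)]
    refine Nat.card_congr (Equiv.subtypeEquiv (Equiv.piCongrRight fun _ => log) fun x => ?_)
    rw [funext_iff, funext_iff]
    refine forall_congr' fun i => ?_
    rw [← log.injective.eq_iff, hlog]
    have : log (u i) = (((ind (u i) : ℕ) : ℤ) : ZMod m) := (Int.cast_natCast _).symm
    rw [this]
    rfl
  refine Nat.card_subtype_comp_eq_mul _ P _ _ (fun x => ?_) fun u hu => by rw [hfiber, if_pos hu]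
  by_contra h
  have := hfiber fun i => ∏ j : Fin n, x j ^ E i (j : ℕ)
  rw [if_neg h, Nat.card_eq_zero] at this
  rcases this with h | h
  · exact h.elim ⟨x, rfl⟩
  · exact not_finite_iff_infinite.2 h inferInstance

theorem Nat.card_fin_add_arrow {X : Type*} (a b : ℕ) (p : (Fin a → X) → Prop)
    (r : (Fin b → X) → Prop) :
    Nat.card {x : Fin (a + b) → X //
        p (fun j => x (Fin.castAdd b j)) ∧ r (fun j => x (Fin.natAdd a j))} =
      Nat.card {y // p y} * Nat.card {z // r z} := by
  rw [← Nat.card_prod, ← Nat.card_congr Equiv.subtypeProdEquivProd]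
  refine Nat.card_congr (Equiv.subtypeEquiv (Fin.appendEquiv a b).symm fun x => ?_)
  rfl

theorem Nat.card_subtype_and_add_card_subtype_and_not {X : Type*} [Finite X] (p r : X → Prop) :
    Nat.card {x // p x ∧ r x} + Nat.card {x // p x ∧ ¬ r x} = Nat.card {x // p x} := by
  classical
  have := Fintype.ofFinite X
  simp only [Nat.card_eq_fintype_card, Fintype.card_subtype, ← Finset.filter_filter]
  exact Finset.card_filter_add_card_filter_not _

theorem card_forall_ne_zero (F : Type*) [Field F] [Fintype F] (a : ℕ) :
    Nat.card {x : Fin a → F // ∀ j, x j ≠ 0} = (Fintype.card F - 1) ^ a := by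
  classical
  rw [Nat.card_congr (Equiv.subtypePiEquivPi (p := fun (_ : Fin a) (z : F) => z ≠ 0)), Nat.card_pi]
  simp [Nat.card_eq_fintype_card, Fintype.card_subtype_compl]

theorem card_exists_eq_zero (F : Type*) [Field F] [Fintype F] {a n : ℕ} (han : a ≤ n) :
    Nat.card {x : Fin n → F // ∃ j : Fin n, (j : ℕ) < a ∧ x j = 0} =
      Fintype.card F ^ (n - a) * (Fintype.card F ^ a - (Fintype.card F - 1) ^ a) := by
  obtain ⟨b, rfl⟩ := Nat.exists_eq_add_of_le han
  have h := Nat.card_subtype_and_add_card_subtype_and_not (fun _ : Fin a → F => True)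
    (fun x => ∀ j, x j ≠ 0)
  simp only [true_and, card_forall_ne_zero] at h
  have h' := Nat.card_fin_add_arrow (X := F) a b (fun y => ¬ ∀ j, y j ≠ 0) (fun _ => True)
  have htot : ∀ c, Nat.card {_x : Fin c → F // True} = Fintype.card F ^ c := by
    intro c
    rw [Nat.card_congr (Equiv.subtypeUnivEquiv fun _ => trivial)]
    simp
  rw [htot] at h h'
  rw [← h, Nat.add_sub_cancel_left, Nat.add_sub_cancel_left, mul_comm, ← h']
  refine Nat.card_congr (Equiv.subtypeEquivRight fun x => ?_)
  push Not
  constructor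
  · rintro ⟨j, hj, hx⟩
    exact ⟨⟨⟨j, hj⟩, hx⟩, trivial⟩
  · rintro ⟨⟨j, hx⟩, -⟩
    exact ⟨_, j.2, hx⟩

theorem prod_fin_add_pow {X : Type*} [CommMonoid X] {a b : ℕ} (x : Fin (a + b) → X) (e : ℕ → ℕ)
    (he : ∀ j, a ≤ j → e j = 0) :
    ∏ j : Fin (a + b), x j ^ e (j : ℕ) = ∏ j : Fin a, x (Fin.castAdd b j) ^ e (j : ℕ) := by
  rw [Fin.prod_univ_add]
  simp [he]

/-- Points whose first `n'` coordinates are nonzero, with a condition on monomials in these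
coordinates and an arbitrary condition on the remaining ones. -/
theorem IsSmithDatum.card_monomials_and {F : Type*} [Field F] [Fintype F] {m : ℕ}
    (hm : m = Fintype.card F - 1) (α : Fˣ) (hα : ∀ β : Fˣ, β ∈ Subgroup.zpowers α) (ind : Fˣ → ℕ)
    (hind : ∀ β : Fˣ, α ^ ind β = β) {ρ n' b : ℕ} {M : Matrix (Fin ρ) (Fin (n' + b)) ℤ}
    {U : Matrix (Fin ρ) (Fin ρ) ℤ} {V : Matrix (Fin (n' + b)) (Fin (n' + b)) ℤ}
    {s : ℕ} {d : ℕ → ℕ} (hM : IsSmithDatum M U V s d) (E : Fin ρ → ℕ → ℕ)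
    (hE : ∀ i j, M i j = E i (j : ℕ)) (hz : ∀ i j, n' ≤ j → E i j = 0)
    (P : (Fin ρ → F) → Prop) (r : (Fin b → F) → Prop) :
    Nat.card {x : Fin (n' + b) → F // (∀ j : Fin (n' + b), (j : ℕ) < n' → x j ≠ 0) ∧
        P (fun i => ∏ j : Fin (n' + b), x j ^ E i (j : ℕ)) ∧ r (fun j => x (Fin.natAdd n' j))} =
      Nat.card {u : Fin ρ → Fˣ // P (fun i => (u i : F)) ∧
          IndexCond m U s d fun i => (ind (u i) : ℤ)} * m ^ (n' - s) *
        (∏ j ∈ Finset.range s, Nat.gcd m (d j)) * Nat.card {z // r z} := by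
  have hmG : m = Nat.card Fˣ := by
    classical
    rw [Nat.card_eq_fintype_card, Fintype.card_units, hm]
  have hm0 : 0 < m := hmG ▸ Nat.card_pos
  have hs : s ≤ n' := hM.le_of_columns_eq_zero (Nat.le_add_right _ _) fun i j hj => by
    rw [hE, hz i j hj, Nat.cast_zero]
  have hprodF := fun (x : Fin (n' + b) → F) i => prod_fin_add_pow x (E i) (hz i)
  have hprodU := fun (x : Fin (n' + b) → Fˣ) i => prod_fin_add_pow x (E i) (hz i)
  have htorus := hM.card_monomials hmG α hα ind hind E hE fun u => P fun i => (u i : F)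
  have hsplit := Nat.card_fin_add_arrow (X := Fˣ) n' b
    (fun y => P fun i => ((∏ j : Fin n', y j ^ E i (j : ℕ) : Fˣ) : F)) (fun _ => True)
  have hb : Nat.card {_z : Fin b → Fˣ // True} = m ^ b := by
    rw [Nat.card_congr (Equiv.subtypeUnivEquiv fun _ => trivial), Nat.card_fun, ← hmG]
    simp
  simp only [hprodU] at htorus
  simp only [hprodF]
  simp only [and_true, hb, htorus] at hsplit
  have hcount : Nat.card {y : Fin n' → Fˣ //
        P fun i => ((∏ j : Fin n', y j ^ E i (j : ℕ) : Fˣ) : F)} =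
      Nat.card {u : Fin ρ → Fˣ // P (fun i => (u i : F)) ∧
          IndexCond m U s d fun i => (ind (u i) : ℤ)} * m ^ (n' - s) *
        (∏ j ∈ Finset.range s, Nat.gcd m (d j)) := by
    refine Nat.eq_of_mul_eq_mul_right (pow_pos hm0 b) ?_
    rw [← hsplit, Nat.sub_add_comm hs, pow_add]
    ring
  have hunits : Nat.card {y : Fin n' → Fˣ //
        P fun i => ((∏ j : Fin n', y j ^ E i (j : ℕ) : Fˣ) : F)} =
      Nat.card {y : Fin n' → F // (∀ j, y j ≠ 0) ∧ P fun i => ∏ j : Fin n', y j ^ E i (j : ℕ)} := by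
    refine Nat.card_congr
      { toFun := fun y => ⟨fun j => y.1 j, fun j => (y.1 j).ne_zero, by simpa using y.2⟩
        invFun := fun y => ⟨fun j => Units.mk0 (y.1 j) (y.2.1 j), by simpa using y.2.2⟩
        left_inv := fun y => by ext; simp
        right_inv := fun y => by ext; simp }
  rw [← hcount, hunits, ← Nat.card_fin_add_arrow]
  refine Nat.card_congr (Equiv.subtypeEquivRight fun x => ?_)
  rw [← and_assoc]
  refine and_congr_left fun _ => and_congr_left fun _ => ⟨fun h j => h _ j.2, fun h j hj => h ⟨j, hj⟩⟩

/-- Points whose first `n'` coordinates are nonzero and one of whose following coordinates, up to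
index `n''`, vanishes, with a condition on monomials in the first `n'` coordinates. -/
theorem IsSmithDatum.card_monomials_exists_eq_zero {F : Type*} [Field F] [Fintype F] {m : ℕ}
    (hm : m = Fintype.card F - 1) (α : Fˣ) (hα : ∀ β : Fˣ, β ∈ Subgroup.zpowers α) (ind : Fˣ → ℕ)
    (hind : ∀ β : Fˣ, α ^ ind β = β) {ρ n' n'' n : ℕ} (hn' : n' ≤ n'') (hn'' : n'' ≤ n)
    {M : Matrix (Fin ρ) (Fin n) ℤ} {U : Matrix (Fin ρ) (Fin ρ) ℤ} {V : Matrix (Fin n) (Fin n) ℤ}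
    {s : ℕ} {d : ℕ → ℕ} (hM : IsSmithDatum M U V s d) (E : Fin ρ → ℕ → ℕ)
    (hE : ∀ i j, M i j = E i (j : ℕ)) (hz : ∀ i j, n' ≤ j → E i j = 0)
    (P : (Fin ρ → F) → Prop) :
    Nat.card {x : Fin n → F // (∀ j : Fin n, (j : ℕ) < n' → x j ≠ 0) ∧
        P (fun i => ∏ j : Fin n, x j ^ E i (j : ℕ)) ∧
          ∃ j : Fin n, n' ≤ (j : ℕ) ∧ (j : ℕ) < n'' ∧ x j = 0} =
      Fintype.card F ^ (n - n'') * (Fintype.card F ^ (n'' - n') - m ^ (n'' - n')) *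
        (Nat.card {u : Fin ρ → Fˣ // P (fun i => (u i : F)) ∧
          IndexCond m U s d fun i => (ind (u i) : ℤ)} * m ^ (n' - s) *
        ∏ j ∈ Finset.range s, Nat.gcd m (d j)) := by
  obtain ⟨a, rfl⟩ := Nat.exists_eq_add_of_le hn'
  obtain ⟨b, rfl⟩ := Nat.exists_eq_add_of_le (hn'.trans hn'')
  have h := hM.card_monomials_and hm α hα ind hind E hE hz P
    (fun z => ∃ j : Fin b, (j : ℕ) < a ∧ z j = 0)
  rw [card_exists_eq_zero F (Nat.le_of_add_le_add_left hn''), ← hm] at h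
  rw [Nat.add_sub_add_left, Nat.add_sub_cancel_left, Nat.mul_comm, ← h]
  refine Nat.card_congr (Equiv.subtypeEquivRight fun x => ?_)
  refine and_congr_right fun _ => and_congr_right fun _ => ⟨?_, ?_⟩
  · rintro ⟨j, h₁, h₂, hj⟩
    refine ⟨⟨j - n', by lia⟩, by simp only; lia, ?_⟩
    exact (congrArg x (Fin.ext (by simp [h₁]))).trans hj
  · rintro ⟨j, h₁, hj⟩
    exact ⟨_, by simp, by simpa using h₁, hj⟩

theorem IsSmithDatum.card_monomials_forall_ne_zero {F : Type*} [Field F] [Fintype F] {m : ℕ}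
    (hm : m = Fintype.card F - 1) (α : Fˣ) (hα : ∀ β : Fˣ, β ∈ Subgroup.zpowers α) (ind : Fˣ → ℕ)
    (hind : ∀ β : Fˣ, α ^ ind β = β) {ρ n : ℕ}
    {M : Matrix (Fin ρ) (Fin n) ℤ} {U : Matrix (Fin ρ) (Fin ρ) ℤ} {V : Matrix (Fin n) (Fin n) ℤ}
    {s : ℕ} {d : ℕ → ℕ} (hM : IsSmithDatum M U V s d) (E : Fin ρ → ℕ → ℕ)
    (hE : ∀ i j, M i j = E i (j : ℕ)) (hz : ∀ i j, n ≤ j → E i j = 0)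
    (P : (Fin ρ → F) → Prop) :
    Nat.card {x : Fin n → F // (∀ j : Fin n, x j ≠ 0) ∧
        P (fun i => ∏ j : Fin n, x j ^ E i (j : ℕ))} =
      Nat.card {u : Fin ρ → Fˣ // P (fun i => (u i : F)) ∧
          IndexCond m U s d fun i => (ind (u i) : ℤ)} * m ^ (n - s) *
        ∏ j ∈ Finset.range s, Nat.gcd m (d j) := by
  have h := hM.card_monomials_and (n' := n) (b := 0) hm α hα ind hind E hE hz P fun _ => True
  have h₁ : Nat.card {_z : Fin 0 → F // True} = 1 := by simp
  rw [h₁, mul_one] at h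
  rw [← h]
  refine Nat.card_congr (Equiv.subtypeEquivRight fun x => ?_)
  simp

theorem prod_pow_eq_zero_of_eq_zero {F : Type*} [Field F] {n : ℕ} {x : Fin n → F} {j : Fin n}
    (hj : x j = 0) {e : ℕ → ℕ} (he : 0 < e j) : ∏ j : Fin n, x j ^ e (j : ℕ) = 0 :=
  Finset.prod_eq_zero (Finset.mem_univ j) (by rw [hj, zero_pow he.ne'])

theorem sum_range_mul_eq_of_tail_eq_zero {R : Type*} [Semiring R] {p r : ℕ} (hpr : p ≤ r)
    (a f : ℕ → R) (hf : ∀ i, p ≤ i → i < r → f i = 0) :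
    ∑ i ∈ Finset.range r, a i * f i = ∑ i ∈ Finset.range p, a i * f i := by
  refine (Finset.sum_subset (Finset.range_subset_range.2 hpr) fun i hi hi' => ?_).symm
  rw [Finset.mem_range] at hi hi'
  rw [hf i (not_lt.1 hi') hi, mul_zero]

theorem sum_fin_add_ite_lt {R : Type*} [AddCommMonoid R] (p₁ p₂ : ℕ) (f : ℕ → R) :
    (∑ i : Fin (p₁ + p₂), if (i : ℕ) < p₁ then f i else 0) = ∑ i ∈ Finset.range p₁, f i := by
  rw [Fin.sum_univ_add, Finset.sum_range]
  simp

theorem sum_fin_add_ite_ge {R : Type*} [AddCommMonoid R] (p₁ p₂ : ℕ) (f : ℕ → R) :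
    (∑ i : Fin (p₁ + p₂), if p₁ ≤ (i : ℕ) then f (i - p₁) else 0) =
      ∑ i ∈ Finset.range p₂, f i := by
  rw [Fin.sum_univ_add, Finset.sum_range]
  simp [Nat.not_le.2 (Fin.is_lt _)]

/-- The rows of `stackM E₁ E₂ p₁ p₂ n`, as functions on `ℕ`. -/
def stackRow (E₁ E₂ : ℕ → ℕ → ℕ) (p₁ i : ℕ) : ℕ → ℕ :=
  if i < p₁ then E₁ i else E₂ (i - p₁)

theorem stackM_apply_eq_stackRow (E₁ E₂ : ℕ → ℕ → ℕ) (p₁ p₂ n : ℕ) (i : Fin (p₁ + p₂))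
    (j : Fin n) : stackM E₁ E₂ p₁ p₂ n i j = (stackRow E₁ E₂ p₁ i j : ℤ) := by
  simp only [stackM, stackRow, Matrix.of_apply]
  split_ifs <;> rfl

theorem stackRow_eq_zero {E₁ E₂ : ℕ → ℕ → ℕ} {p₁ p₂ n : ℕ}
    (h₁ : ∀ i, i < p₁ → ∀ j, n ≤ j → E₁ i j = 0) (h₂ : ∀ i, i < p₂ → ∀ j, n ≤ j → E₂ i j = 0)
    (i : Fin (p₁ + p₂)) (j : ℕ) (hj : n ≤ j) : stackRow E₁ E₂ p₁ i j = 0 := by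
  unfold stackRow
  split_ifs with h
  · exact h₁ i h j hj
  · exact h₂ _ (by lia) j hj

theorem sum_stackRow_left {F : Type*} [Field F] (a : ℕ → Fˣ) (E₁ E₂ : ℕ → ℕ → ℕ) (p₁ p₂ n : ℕ)
    (x : Fin n → F) :
    (∑ i : Fin (p₁ + p₂), if (i : ℕ) < p₁ then
        (a i : F) * ∏ j : Fin n, x j ^ stackRow E₁ E₂ p₁ i (j : ℕ) else 0) =
      ∑ i ∈ Finset.range p₁, (a i : F) * ∏ j : Fin n, x j ^ E₁ i (j : ℕ) := by
  rw [← sum_fin_add_ite_lt p₁ p₂]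
  refine Finset.sum_congr rfl fun i _ => ?_
  split_ifs with h
  · simp only [stackRow, if_pos h]
  · rfl

theorem sum_stackRow_right {F : Type*} [Field F] (a : ℕ → Fˣ) (E₁ E₂ : ℕ → ℕ → ℕ) (p₁ p₂ n : ℕ)
    (x : Fin n → F) :
    (∑ i : Fin (p₁ + p₂), if p₁ ≤ (i : ℕ) then
        (a (i - p₁) : F) * ∏ j : Fin n, x j ^ stackRow E₁ E₂ p₁ i (j : ℕ) else 0) =
      ∑ i ∈ Finset.range p₂, (a i : F) * ∏ j : Fin n, x j ^ E₂ i (j : ℕ) := by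
  rw [← sum_fin_add_ite_ge p₁ p₂]
  refine Finset.sum_congr rfl fun i _ => ?_
  split_ifs with h
  · simp only [stackRow, if_neg (not_lt.2 h)]
  · rfl

theorem rational_points_case_n2_eq_n3
    (F : Type) [Field F] [Fintype F] [DecidableEq F]
    (q : ℕ) (hq : q = Fintype.card F)
    (hqpow : ∃ p k : ℕ, Nat.Prime p ∧ Odd p ∧ 0 < k ∧ q = p ^ k)
    (α : Fˣ) (hα : ∀ β : Fˣ, β ∈ Subgroup.zpowers α)
    (ind : Fˣ → ℕ)
    (hind : ∀ β : Fˣ, 1 ≤ ind β ∧ ind β ≤ q - 1 ∧ α ^ ind β = β)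
    (r₁ r₂ r₃ r₄ n₁ n₂ n₃ n₄ : ℕ)
    (hr₁ : 0 < r₁) (hr₁₂ : r₁ < r₂) (hr₃ : 0 < r₃) (hr₃₄ : r₃ < r₄)
    (hn₁ : 0 < n₁) (hn₁₂ : n₁ < n₂) (hn₃ : 0 < n₃) (hn₃₄ : n₃ < n₄)
    (hn₁₃ : n₁ ≤ n₃)
    (b₁ b₂ : F) (a₁ a₂ : ℕ → Fˣ)
    (E₁ E₂ : ℕ → ℕ → ℕ)
    (hE₁p : ∀ i, i < r₁ → ∀ j, j < n₁ → 0 < E₁ i j)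
    (hE₁z : ∀ i, i < r₁ → ∀ j, n₁ ≤ j → E₁ i j = 0)
    (hE₁p' : ∀ i, r₁ ≤ i → i < r₂ → ∀ j, j < n₂ → 0 < E₁ i j)
    (hE₁z' : ∀ i, r₁ ≤ i → i < r₂ → ∀ j, n₂ ≤ j → E₁ i j = 0)
    (hE₂p : ∀ i, i < r₃ → ∀ j, j < n₃ → 0 < E₂ i j)
    (hE₂z : ∀ i, i < r₃ → ∀ j, n₃ ≤ j → E₂ i j = 0)
    (hE₂p' : ∀ i, r₃ ≤ i → i < r₄ → ∀ j, j < n₄ → 0 < E₂ i j)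
    (hE₂z' : ∀ i, r₃ ≤ i → i < r₄ → ∀ j, n₄ ≤ j → E₂ i j = 0)
    (h₂₃ : n₂ = n₃)
    (U₁ : Matrix (Fin (r₁)) (Fin (r₁)) ℤ) (V₁ : Matrix (Fin (n₄)) (Fin (n₄)) ℤ)
    (s₁ : ℕ) (d₁ : ℕ → ℕ)
    (hSD₁ : IsSmithDatum ((Matrix.of fun (i : Fin (r₁)) (j : Fin (n₄)) => (E₁ (i : ℕ) (j : ℕ) : ℤ))) U₁ V₁ s₁ d₁)
    (U₃ : Matrix (Fin (r₂ + r₃)) (Fin (r₂ + r₃)) ℤ) (V₃ : Matrix (Fin (n₄)) (Fin (n₄)) ℤ)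
    (s₃ : ℕ) (d₃ : ℕ → ℕ)
    (hSD₃ : IsSmithDatum (stackM E₁ E₂ r₂ r₃ n₄) U₃ V₃ s₃ d₃)
    (U₄ : Matrix (Fin (r₂ + r₄)) (Fin (r₂ + r₄)) ℤ) (V₄ : Matrix (Fin (n₄)) (Fin (n₄)) ℤ)
    (s₄ : ℕ) (d₄ : ℕ → ℕ)
    (hSD₄ : IsSmithDatum (stackM E₁ E₂ r₂ r₄ n₄) U₄ V₄ s₄ d₄)
    (H₁ : ℕ)
    (hH₁ : H₁ = Nat.card {u : Fin (r₁) → Fˣ //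
      (∑ i : Fin (r₁), (a₁ (i : ℕ) : F) * ((u i : F))) = b₁ ∧
      IndexCond (q - 1) U₁ s₁ d₁ fun i => (ind (u i) : ℤ)})
    (H₃ : ℕ)
    (hH₃ : H₃ = Nat.card {w : Fin (r₂ + r₃) → Fˣ //
      (∑ i : Fin (r₂ + r₃), if (i : ℕ) < r₂ then (a₁ (i : ℕ) : F) * ((w i : F)) else 0) = b₁ ∧
      (∑ i : Fin (r₂ + r₃), if r₂ ≤ (i : ℕ) then (a₂ ((i : ℕ) - r₂) : F) * ((w i : F)) else 0) = b₂ ∧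
      IndexCond (q - 1) U₃ s₃ d₃ fun i => (ind (w i) : ℤ)})
    (H₄ : ℕ)
    (hH₄ : H₄ = Nat.card {w : Fin (r₂ + r₄) → Fˣ //
      (∑ i : Fin (r₂ + r₄), if (i : ℕ) < r₂ then (a₁ (i : ℕ) : F) * ((w i : F)) else 0) = b₁ ∧
      (∑ i : Fin (r₂ + r₄), if r₂ ≤ (i : ℕ) then (a₂ ((i : ℕ) - r₂) : F) * ((w i : F)) else 0) = b₂ ∧
      IndexCond (q - 1) U₄ s₄ d₄ fun i => (ind (w i) : ℤ)})
    (L₁ : ℕ)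
    (hL₁ : L₁ = H₁ * (q - 1) ^ (n₁ - s₁) * ∏ j ∈ Finset.range s₁, Nat.gcd (q - 1) (d₁ j))
    (L₃ : ℕ)
    (hL₃ : L₃ = H₃ * (q - 1) ^ (n₃ - s₃) * ∏ j ∈ Finset.range s₃, Nat.gcd (q - 1) (d₃ j))
    (L₄ : ℕ)
    (hL₄ : L₄ = H₄ * (q - 1) ^ (n₄ - s₄) * ∏ j ∈ Finset.range s₄, Nat.gcd (q - 1) (d₄ j))
    :
    Nat.card {x : Fin (n₄) → F //
      (∑ i ∈ Finset.range r₂, (a₁ i : F) * ∏ j : Fin (n₄), x j ^ E₁ i (j : ℕ)) = b₁ ∧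
      (∑ i ∈ Finset.range r₄, (a₂ i : F) * ∏ j : Fin (n₄), x j ^ E₂ i (j : ℕ)) = b₂} =
      (if b₁ = 0 ∧ b₂ = 0 then q ^ (n₄ - n₁) * (q ^ n₁ - (q - 1) ^ n₁) else 0) +
      (if b₂ = 0 then q ^ (n₄ - n₂) * (q ^ (n₂ - n₁) - (q - 1) ^ (n₂ - n₁)) * L₁ else 0) +
      (q ^ (n₄ - n₃) - (q - 1) ^ (n₄ - n₃)) * L₃ +
      L₄ := by
  subst h₂₃
  have hm : q - 1 = Fintype.card F - 1 := by rw [hq]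
  have hind' : ∀ β : Fˣ, α ^ ind β = β := fun β => (hind β).2.2
  have hE₁z₂ : ∀ i, i < r₂ → ∀ j, n₂ ≤ j → E₁ i j = 0 := fun i hi j hj =>
    (lt_or_ge i r₁).elim (fun h => hE₁z i h j (by lia)) fun h => hE₁z' i h hi j hj
  have hE₂z₄ : ∀ i, i < r₄ → ∀ j, n₄ ≤ j → E₂ i j = 0 := fun i hi j hj =>
    (lt_or_ge i r₃).elim (fun h => hE₂z i h j (by lia)) fun h => hE₂z' i h hi j hj
  let S : (ℕ → Fˣ) → (ℕ → ℕ → ℕ) → ℕ → (Fin n₄ → F) → F := fun a E r x =>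
    ∑ i ∈ Finset.range r, (a i : F) * ∏ j : Fin n₄, x j ^ E i (j : ℕ)
  have hS : ∀ (a : ℕ → Fˣ) (E : ℕ → ℕ → ℕ) (p r : ℕ) (x : Fin n₄ → F) (j : Fin n₄), p ≤ r →
      x j = 0 → (∀ i, p ≤ i → i < r → 0 < E i j) → S a E r x = S a E p x :=
    fun a E p r x j hpr hj hE => sum_range_mul_eq_of_tail_eq_zero hpr (fun i => (a i : F)) _
      fun i hi hi' => prod_pow_eq_zero_of_eq_zero hj (hE i hi hi')
  have hS₀ : ∀ a E x, S a E 0 x = 0 := fun a E x => Finset.sum_range_zero _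
  have hE₁p₁ : ∀ i, i < r₂ → ∀ j, j < n₁ → 0 < E₁ i j := fun i hi j hj =>
    (lt_or_ge i r₁).elim (fun h => hE₁p i h j hj) fun h => hE₁p' i h hi j (by lia)
  have hE₂p₂ : ∀ i, i < r₄ → ∀ j, j < n₂ → 0 < E₂ i j := fun i hi j hj =>
    (lt_or_ge i r₃).elim (fun h => hE₂p i h j hj) fun h => hE₂p' i h hi j (by lia)
  let Q : (Fin n₄ → F) → Prop := fun x => S a₁ E₁ r₂ x = b₁ ∧ S a₂ E₂ r₄ x = b₂
  let T : ℕ → (Fin n₄ → F) → Prop := fun k x => ∀ j : Fin n₄, (j : ℕ) < k → x j ≠ 0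
  have hsplit₁ := Nat.card_subtype_and_add_card_subtype_and_not Q (T n₁)
  have hsplit₂ := Nat.card_subtype_and_add_card_subtype_and_not (fun x => Q x ∧ T n₁ x) (T n₂)
  have hsplit₃ := Nat.card_subtype_and_add_card_subtype_and_not
    (fun x => (Q x ∧ T n₁ x) ∧ T n₂ x) (T n₄)
  have hN₀ : Nat.card {x // Q x ∧ ¬ T n₁ x} =
      if b₁ = 0 ∧ b₂ = 0 then q ^ (n₄ - n₁) * (q ^ n₁ - (q - 1) ^ n₁) else 0 := by
    have hQ : ∀ x, ¬ T n₁ x → (Q x ↔ b₁ = 0 ∧ b₂ = 0) := by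
      intro x hx
      simp only [T] at hx
      push Not at hx
      obtain ⟨j, hj, hxj⟩ := hx
      simp only [Q]
      rw [hS a₁ E₁ 0 r₂ x j (Nat.zero_le _) hxj fun i _ hi => hE₁p₁ i hi j hj,
        hS a₂ E₂ 0 r₄ x j (Nat.zero_le _) hxj fun i _ hi => hE₂p₂ i hi j (by lia), hS₀, hS₀,
        eq_comm, eq_comm (a := (0 : F)) (b := b₂)]
    split_ifs with hb
    · rw [hq, ← card_exists_eq_zero F (hn₁₂.le.trans hn₃₄.le)]
      refine Nat.card_congr (Equiv.subtypeEquivRight fun x => ?_)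
      rw [and_congr_left (hQ x), and_iff_right hb]
      simp [T]
    · rw [Nat.card_eq_zero]
      exact Or.inl ⟨fun x => hb ((hQ x.1 x.2.2).1 x.2.1)⟩
  have hN₁ : Nat.card {x // (Q x ∧ T n₁ x) ∧ ¬ T n₂ x} =
      if b₂ = 0 then q ^ (n₄ - n₂) * (q ^ (n₂ - n₁) - (q - 1) ^ (n₂ - n₁)) * L₁ else 0 := by
    have hQ : ∀ x, ¬ T n₂ x → T n₁ x → (Q x ↔ S a₁ E₁ r₁ x = b₁ ∧ b₂ = 0) := by
      intro x hx hx₁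
      simp only [T] at hx
      push Not at hx
      obtain ⟨j, hj, hxj⟩ := hx
      simp only [Q]
      rw [hS a₁ E₁ r₁ r₂ x j hr₁₂.le hxj fun i hi hi' => hE₁p' i hi hi' j hj,
        hS a₂ E₂ 0 r₄ x j (Nat.zero_le _) hxj fun i _ hi => hE₂p₂ i hi j hj, hS₀,
        eq_comm (a := (0 : F)) (b := b₂)]
    split_ifs with hb
    · rw [hL₁, hH₁, hq, ← hSD₁.card_monomials_exists_eq_zero rfl α hα ind hind' hn₁₂.le hn₃₄.le
        (fun i => E₁ i) (fun _ _ => rfl) (fun i j hj => hE₁z i i.2 j hj)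
        (fun u => ∑ i : Fin r₁, (a₁ (i : ℕ) : F) * u i = b₁)]
      refine Nat.card_congr (Equiv.subtypeEquivRight fun x => ?_)
      have hsum : S a₁ E₁ r₁ x =
          ∑ i : Fin r₁, (a₁ (i : ℕ) : F) * ∏ j : Fin n₄, x j ^ E₁ i (j : ℕ) :=
        Finset.sum_range _
      rw [← hsum]
      constructor
      · rintro ⟨⟨hQx, hx₁⟩, hx₂⟩
        refine ⟨hx₁, ((hQ x hx₂ hx₁).1 hQx).1, ?_⟩
        simp only [T] at hx₂
        push Not at hx₂
        obtain ⟨j, hj, hxj⟩ := hx₂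
        exact ⟨j, not_lt.1 fun h => hx₁ j h hxj, hj, hxj⟩
      · rintro ⟨hx₁, hs, j, -, hj, hxj⟩
        have hx₂ : ¬ T n₂ x := fun h => h j hj hxj
        exact ⟨⟨(hQ x hx₂ hx₁).2 ⟨hs, hb⟩, hx₁⟩, hx₂⟩
    · rw [Nat.card_eq_zero]
      exact Or.inl ⟨fun x => hb ((hQ x.1 x.2.2 x.2.1.2).1 x.2.1.1).2⟩
  have hN₃ : Nat.card {x // ((Q x ∧ T n₁ x) ∧ T n₂ x) ∧ ¬ T n₄ x} =
      (q ^ (n₄ - n₂) - (q - 1) ^ (n₄ - n₂)) * L₃ := by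
    have hQ : ∀ x, ¬ T n₄ x → T n₂ x → (Q x ↔ S a₁ E₁ r₂ x = b₁ ∧ S a₂ E₂ r₃ x = b₂) := by
      intro x hx hx₁
      simp only [T] at hx
      push Not at hx
      obtain ⟨j, hj, hxj⟩ := hx
      simp only [Q]
      rw [hS a₂ E₂ r₃ r₄ x j hr₃₄.le hxj fun i hi hi' => hE₂p' i hi hi' j hj]
    have h := hSD₃.card_monomials_exists_eq_zero hm α hα ind hind' hn₃₄.le le_rfl
      (fun i => stackRow E₁ E₂ r₂ i) (stackM_apply_eq_stackRow E₁ E₂ r₂ r₃ n₄)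
      (stackRow_eq_zero hE₁z₂ hE₂z)
      (fun w => (∑ i : Fin _, if (i : ℕ) < r₂ then (a₁ (i : ℕ) : F) * w i else 0) = b₁ ∧
        (∑ i : Fin _, if r₂ ≤ (i : ℕ) then (a₂ ((i : ℕ) - r₂) : F) * w i else 0) = b₂)
    simp only [and_assoc, Nat.sub_self, pow_zero, one_mul, ← hq, sum_stackRow_left,
      sum_stackRow_right] at h
    rw [hL₃, hH₃, ← h]
    refine Nat.card_congr (Equiv.subtypeEquivRight fun x => ?_)
    constructor
    · rintro ⟨⟨⟨hQx, -⟩, hx₂⟩, hx₃⟩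
      obtain ⟨h₁, h₂⟩ := (hQ x hx₃ hx₂).1 hQx
      refine ⟨hx₂, h₁, h₂, ?_⟩
      simp only [T] at hx₃
      push Not at hx₃
      obtain ⟨j, hj, hxj⟩ := hx₃
      exact ⟨j, not_lt.1 fun h => hx₂ j h hxj, hj, hxj⟩
    · rintro ⟨hx₂, h₁, h₂, j, -, hj, hxj⟩
      have hx₃ : ¬ T n₄ x := fun h => h j hj hxj
      exact ⟨⟨⟨(hQ x hx₃ hx₂).2 ⟨h₁, h₂⟩, fun j hj => hx₂ j (hj.trans hn₁₂)⟩, hx₂⟩, hx₃⟩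
  have hN₄ : Nat.card {x // ((Q x ∧ T n₁ x) ∧ T n₂ x) ∧ T n₄ x} = L₄ := by
    have h := hSD₄.card_monomials_forall_ne_zero hm α hα ind hind'
      (fun i => stackRow E₁ E₂ r₂ i) (stackM_apply_eq_stackRow E₁ E₂ r₂ r₄ n₄)
      (stackRow_eq_zero (fun i hi j hj => hE₁z₂ i hi j (hn₃₄.le.trans hj)) hE₂z₄)
      (fun w => (∑ i : Fin _, if (i : ℕ) < r₂ then (a₁ (i : ℕ) : F) * w i else 0) = b₁ ∧
        (∑ i : Fin _, if r₂ ≤ (i : ℕ) then (a₂ ((i : ℕ) - r₂) : F) * w i else 0) = b₂)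
    simp only [and_assoc, sum_stackRow_left, sum_stackRow_right] at h
    rw [hL₄, hH₄, ← h]
    refine Nat.card_congr (Equiv.subtypeEquivRight fun x => ?_)
    constructor
    · rintro ⟨⟨⟨hQx, -⟩, -⟩, hx⟩
      exact ⟨fun j => hx j j.2, hQx⟩
    · rintro ⟨hx, hQx⟩
      exact ⟨⟨⟨hQx, fun j _ => hx j⟩, fun j _ => hx j⟩, fun j _ => hx j⟩
  change Nat.card {x // Q x} = _
  rw [← hN₀, ← hN₁, ← hN₃, ← hN₄, ← hsplit₁, ← hsplit₂, ← hsplit₃]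
  ring
end
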